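/- For every integer n ≥ 50, the first-order forward difference of the overpartition function satisfies the Laguerre inequality of order 2: 3(Δ\bar{p}(n+2))^2 − 4(Δ\bar{p}(n+1))·(Δ\bar{p}(n+3)) + (Δ\bar{p}(n))·(Δ\bar{p}(n+4)) > 0. -/

import Mathlib

/-- The overpartition function: `Σ_{λ ⊢ n} 2^{d(λ)}` where `d(λ)` is the number of
distinct part sizes of the partition `λ`. -/
def overpartitionFn (n : ℕ) : ℕ :=
  ∑ μ : Nat.Partition n, 2 ^ μ.parts.toFinset.card

/-- The first-order forward difference of the overpartition function, as an integer. -/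
def dPbar (n : ℕ) : ℤ := (overpartitionFn (n + 1) : ℤ) - overpartitionFn n

namespace Overpartition

open Finset Filter Topology PowerSeries
open scoped PowerSeries.WithPiTopology

/-- The generating function of the overpartitions of which all parts equal `i + 1`. -/
noncomputable def factor (i : ℕ) : ℤ⟦X⟧ :=
  PowerSeries.mk fun n ↦ if n = 0 then 1 else if i + 1 ∣ n then 2 else 0

/-- The generating function of the overpartitions with parts at most `N`. -/
noncomputable def truncGen (N : ℕ) : ℤ⟦X⟧ := ∏ i ∈ range N, factor i

lemma factor_mul_one_sub (i : ℕ) :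
    factor i * (1 - X ^ (i + 1)) = 1 + X ^ (i + 1) := by
  ext n
  rw [mul_sub, mul_one, map_sub, coeff_mul_X_pow', map_add, coeff_one, coeff_X_pow]
  simp only [factor, coeff_mk]
  rcases lt_trichotomy n (i + 1) with h | h | h
  · have : ¬ i + 1 ≤ n := by omega
    by_cases h0 : n = 0
    · simp [h0]
    · have h1 : ¬ i + 1 ∣ n := Nat.not_dvd_of_pos_of_lt (by omega) h
      simp [h0, h1, this, h.ne]
  · subst h
    simp
  · have h1 : i + 1 ∣ n - (i + 1) ↔ i + 1 ∣ n := by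
      rw [Nat.dvd_sub_iff_left h.le dvd_rfl]
    have h2 : n - (i + 1) ≠ 0 := by omega
    simp [h.le, h2, h.ne', h1, show n ≠ 0 by omega]

lemma truncGen_succ_mul (N : ℕ) :
    truncGen (N + 1) * (1 - X ^ (N + 1)) = truncGen N * (1 + X ^ (N + 1)) := by
  rw [truncGen, prod_range_succ, mul_assoc, factor_mul_one_sub, truncGen]

lemma coeff_truncGen_succ (N n : ℕ) :
    coeff n (truncGen (N + 1)) = coeff n (truncGen N) +
      if N + 1 ≤ n then coeff (n - (N + 1)) (truncGen (N + 1)) + coeff (n - (N + 1)) (truncGen N)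
      else 0 := by
  have h := congrArg (coeff n) (truncGen_succ_mul N)
  rw [mul_sub, mul_add, mul_one, mul_one, map_sub, map_add, coeff_mul_X_pow', coeff_mul_X_pow'] at h
  split_ifs at h ⊢ <;> linarith

lemma coeff_truncGen_nonneg (N n : ℕ) : 0 ≤ coeff n (truncGen N) := by
  induction N generalizing n with
  | zero =>
    rw [truncGen, range_zero, prod_empty, coeff_one]
    split_ifs <;> simp
  | succ N ih =>
    induction n using Nat.strong_induction_on with
    | _ n ihn =>
      rw [coeff_truncGen_succ]
      split_ifs with h
      · linarith [ih n, ih (n - (N + 1)), ihn (n - (N + 1)) (by omega)]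
      · simpa using ih n

lemma coeff_truncGen_mono (n : ℕ) : Monotone fun N ↦ coeff n (truncGen N) := by
  refine monotone_nat_of_le_succ fun N ↦ ?_
  rw [coeff_truncGen_succ N n]
  split_ifs
  · linarith [coeff_truncGen_nonneg N (n - (N + 1)), coeff_truncGen_nonneg (N + 1) (n - (N + 1))]
  · simp

lemma coeff_truncGen_eq {N n : ℕ} (h : n ≤ N) : coeff n (truncGen N) = coeff n (truncGen n) := by
  induction N, h using Nat.le_induction with
  | base => rfl
  | succ N hN ih => rw [coeff_truncGen_succ, if_neg (by omega), add_zero, ih]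

lemma coeff_genFun_two (n : ℕ) :
    coeff n (Nat.Partition.genFun fun _ _ ↦ (2 : ℤ)) = overpartitionFn n := by
  rw [Nat.Partition.coeff_genFun, overpartitionFn]
  push_cast
  refine sum_congr rfl fun p _ ↦ ?_
  rw [Finsupp.prod, prod_const]
  rfl

lemma genFun_term (i : ℕ) :
    (1 + ∑' j, (2 : ℤ) • (X : ℤ⟦X⟧) ^ ((i + 1) * (j + 1))) = factor i := by
  have hs : Summable fun j ↦ (2 : ℤ) • (X : ℤ⟦X⟧) ^ ((i + 1) * (j + 1)) :=
    Nat.Partition.summable_genFun_term (fun _ _ ↦ (2 : ℤ)) i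
  ext n
  rw [map_add, ← ((WithPiTopology.hasSum_iff_hasSum_coeff ℤ).mp hs.hasSum n).tsum_eq, factor,
    coeff_mk, coeff_one]
  simp only [map_zsmul, coeff_X_pow]
  split_ifs with h0 h1
  · subst h0
    simp
  · obtain ⟨k, rfl⟩ := h1
    obtain ⟨k, rfl⟩ := Nat.exists_eq_succ_of_ne_zero (show k ≠ 0 by rintro rfl; simp at h0)
    rw [tsum_eq_single k]
    · simp
    · intro j hj
      simp [Ne.symm hj]
  · rw [zero_add]
    refine (tsum_congr fun j ↦ ?_).trans tsum_zero
    rw [if_neg, smul_zero]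
    rintro rfl
    exact h1 (dvd_mul_right _ _)

lemma coeff_truncGen_self (n : ℕ) : coeff n (truncGen n) = overpartitionFn n := by
  have h := (Nat.Partition.hasProd_genFun fun _ _ ↦ (2 : ℤ)).tendsto_prod_nat
  have h2 := (WithPiTopology.tendsto_iff_coeff_tendsto _ _ _ _).mp
    (h.congr fun N ↦ prod_congr rfl fun i _ ↦ genFun_term i) n
  rw [coeff_genFun_two] at h2
  refine tendsto_nhds_unique ?_ h2
  refine tendsto_atTop_of_eventually_const (i₀ := n) fun N hN ↦ coeff_truncGen_eq hN

lemma coeff_truncGen_of_le {N n : ℕ} (h : n ≤ N) : coeff n (truncGen N) = overpartitionFn n := by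
  rw [coeff_truncGen_eq h, coeff_truncGen_self]

lemma coeff_truncGen_le (N n : ℕ) : coeff n (truncGen N) ≤ overpartitionFn n := by
  rw [← coeff_truncGen_of_le (le_max_right N n)]
  exact coeff_truncGen_mono n (le_max_left N n)

end Overpartition

namespace Overpartition

open Finset Filter Topology PowerSeries

/-- The truncated product `∏_{i ≤ N} (1 + q ^ i) / (1 - q ^ i)`. -/
noncomputable def eulerProd {K : Type*} [Field K] (q : K) (N : ℕ) : K :=
  ∏ i ∈ range N, (1 + q ^ (i + 1)) / (1 - q ^ (i + 1))

lemma one_sub_pow_ne_zero {q : ℂ} (hq : ‖q‖ < 1) (i : ℕ) : 1 - q ^ (i + 1) ≠ 0 := by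
  intro h
  have h1 : ‖q‖ ^ (i + 1) < 1 := pow_lt_one₀ (norm_nonneg _) hq (by simp)
  rw [← norm_pow, ← sub_eq_zero.mp h] at h1
  simp at h1

lemma one_add_pow_ne_zero {q : ℂ} (hq : ‖q‖ < 1) (i : ℕ) : 1 + q ^ (i + 1) ≠ 0 := by
  intro h
  have h1 : ‖q‖ ^ (i + 1) < 1 := pow_lt_one₀ (norm_nonneg _) hq (by simp)
  rw [← norm_pow, eq_neg_of_add_eq_zero_right h] at h1
  simp at h1

lemma exists_tendsto_prod_one_sub {q : ℂ} (hq : ‖q‖ < 1) :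
    ∃ L ≠ 0, Tendsto (fun N ↦ ∏ i ∈ range N, (1 - q ^ (i + 1))) atTop (𝓝 L) := by
  have hs : Summable fun i : ℕ ↦ ‖-q ^ (i + 1)‖ := by
    simpa using (summable_nat_add_iff 1).mpr (summable_geometric_of_lt_one (norm_nonneg _) hq)
  refine ⟨∏' i : ℕ, (1 + -q ^ (i + 1)), tprod_one_add_ne_zero_of_summable (fun i ↦ ?_) hs, ?_⟩
  · rw [← sub_eq_add_neg]
    exact one_sub_pow_ne_zero hq i
  · simpa [sub_eq_add_neg] using (multipliable_one_add_of_summable hs).hasProd.tendsto_prod_nat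

lemma exists_tendsto_prod_one_add {q : ℂ} (hq : ‖q‖ < 1) :
    ∃ L, Tendsto (fun N ↦ ∏ i ∈ range N, (1 + q ^ (i + 1))) atTop (𝓝 L) := by
  have hs : Summable fun i : ℕ ↦ ‖q ^ (i + 1)‖ := by
    simpa using (summable_nat_add_iff 1).mpr (summable_geometric_of_lt_one (norm_nonneg _) hq)
  exact ⟨_, (multipliable_one_add_of_summable hs).hasProd.tendsto_prod_nat⟩

lemma exists_tendsto_eulerProd {q : ℂ} (hq : ‖q‖ < 1) :
    ∃ L, Tendsto (eulerProd q) atTop (𝓝 L) := by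
  obtain ⟨L, hL, h⟩ := exists_tendsto_prod_one_sub hq
  obtain ⟨L', h'⟩ := exists_tendsto_prod_one_add hq
  refine ⟨L' / L, ?_⟩
  refine (h'.div h hL).congr fun N ↦ ?_
  simp [eulerProd, prod_div_distrib]

lemma eulerProd_ofReal (ρ : ℝ) (N : ℕ) : eulerProd (ρ : ℂ) N = (eulerProd ρ N : ℝ) := by
  simp [eulerProd]

lemma exists_eulerProd_le {ρ : ℝ} (h0 : 0 ≤ ρ) (h1 : ρ < 1) : ∃ C, ∀ N, eulerProd ρ N ≤ C := by
  obtain ⟨L, hL⟩ := exists_tendsto_eulerProd (q := (ρ : ℂ)) (by simpa [abs_of_nonneg h0] using h1)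
  obtain ⟨C, hC⟩ := hL.norm.bddAbove_range
  refine ⟨C, fun N ↦ ?_⟩
  have := hC ⟨N, rfl⟩
  simp only [eulerProd_ofReal, Complex.norm_real] at this
  exact (le_abs_self _).trans this

lemma sum_shift_le {f : ℕ → ℝ} {ρ : ℝ} (hf : ∀ n, 0 ≤ f n) (h0 : 0 ≤ ρ) (M k : ℕ) :
    ∑ n ∈ range M, (if k ≤ n then f (n - k) else 0) * ρ ^ n ≤
      ρ ^ k * ∑ n ∈ range M, f n * ρ ^ n := by
  have : ∑ n ∈ range M, (if k ≤ n then f (n - k) else 0) * ρ ^ n ≤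
      ∑ n ∈ range (k + M), (if k ≤ n then f (n - k) else 0) * ρ ^ n := by
    refine sum_le_sum_of_subset_of_nonneg (by simp) fun n _ _ ↦ mul_nonneg ?_ (by positivity)
    split_ifs
    exacts [hf _, le_rfl]
  refine this.trans (le_of_eq ?_)
  rw [sum_range_add, sum_eq_zero, zero_add, mul_sum]
  · refine sum_congr rfl fun n _ ↦ ?_
    simp [pow_add]
    ring
  · intro n hn
    simp [(mem_range.mp hn).not_ge]

lemma sum_truncGen_le {ρ : ℝ} (h0 : 0 ≤ ρ) (h1 : ρ < 1) (N M : ℕ) :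
    ∑ n ∈ range M, ((coeff n (truncGen N) : ℤ) : ℝ) * ρ ^ n ≤ eulerProd ρ N := by
  induction N with
  | zero =>
    simp only [truncGen, eulerProd, range_zero, prod_empty, coeff_one]
    rcases M with _ | M
    · simp
    · rw [sum_range_succ']
      simp
  | succ N ih =>
    have hk : ρ ^ (N + 1) < 1 := pow_lt_one₀ h0 h1 (by simp)
    have hk0 : 0 ≤ ρ ^ (N + 1) := by positivity
    rw [eulerProd, prod_range_succ, ← eulerProd, ← mul_div_assoc, le_div_iff₀ (by linarith)]
    have e : ∑ n ∈ range M, ((coeff n (truncGen (N + 1)) : ℤ) : ℝ) * ρ ^ n =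
        ∑ n ∈ range M, ((coeff n (truncGen N) : ℤ) : ℝ) * ρ ^ n +
        (∑ n ∈ range M, (if N + 1 ≤ n then ((coeff (n - (N + 1)) (truncGen (N + 1)) : ℤ) : ℝ) else 0)
          * ρ ^ n +
        ∑ n ∈ range M, (if N + 1 ≤ n then ((coeff (n - (N + 1)) (truncGen N) : ℤ) : ℝ) else 0)
          * ρ ^ n) := by
      rw [← sum_add_distrib, ← sum_add_distrib]
      refine sum_congr rfl fun n _ ↦ ?_
      rw [coeff_truncGen_succ]
      split_ifs <;> push_cast <;> ring
    have hn : ∀ N n, (0 : ℝ) ≤ (coeff n (truncGen N) : ℤ) := fun N n ↦ by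
      exact_mod_cast coeff_truncGen_nonneg N n
    have a := sum_shift_le (hn (N + 1)) h0 M (N + 1)
    have b := sum_shift_le (hn N) h0 M (N + 1)
    have c := mul_le_mul_of_nonneg_right ih (by linarith : 0 ≤ 1 + ρ ^ (N + 1))
    linarith

lemma summable_overpartitionFn_real {ρ : ℝ} (h0 : 0 ≤ ρ) (h1 : ρ < 1) :
    Summable fun n ↦ (overpartitionFn n : ℝ) * ρ ^ n := by
  obtain ⟨C, hC⟩ := exists_eulerProd_le h0 h1
  refine summable_of_sum_range_le (c := C) (fun n ↦ by positivity) fun M ↦ ?_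
  refine le_trans (le_of_eq (sum_congr rfl fun n hn ↦ ?_))
    ((sum_truncGen_le h0 h1 M M).trans (hC M))
  rw [coeff_truncGen_of_le (mem_range.mp hn).le, Int.cast_natCast]

lemma summable_norm_overpartitionFn {q : ℂ} (hq : ‖q‖ < 1) :
    Summable fun n ↦ ‖(overpartitionFn n : ℂ) * q ^ n‖ := by
  simpa using summable_overpartitionFn_real (norm_nonneg q) hq

lemma norm_truncGen_le (q : ℂ) (N n : ℕ) :
    ‖((coeff n (truncGen N) : ℤ) : ℂ) * q ^ n‖ ≤ ‖(overpartitionFn n : ℂ) * q ^ n‖ := by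
  rw [norm_mul, norm_mul]
  refine mul_le_mul_of_nonneg_right ?_ (norm_nonneg _)
  rw [Complex.norm_intCast, Complex.norm_natCast, abs_of_nonneg]
  · exact_mod_cast coeff_truncGen_le N n
  · exact_mod_cast coeff_truncGen_nonneg N n

lemma hasSum_shift {f : ℕ → ℂ} {q a : ℂ} (h : HasSum (fun n ↦ f n * q ^ n) a) (k : ℕ) :
    HasSum (fun n ↦ (if k ≤ n then f (n - k) else 0) * q ^ n) (q ^ k * a) := by
  rw [← hasSum_nat_add_iff' k, sum_eq_zero, sub_zero]
  · convert! h.mul_left (q ^ k) using 1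
    ext n
    simp [pow_add]
    ring
  · intro n hn
    simp [(mem_range.mp hn).not_ge]

lemma hasSum_truncGen {q : ℂ} (hq : ‖q‖ < 1) (N : ℕ) :
    HasSum (fun n ↦ ((coeff n (truncGen N) : ℤ) : ℂ) * q ^ n) (eulerProd q N) := by
  induction N with
  | zero =>
    convert! hasSum_single (f := fun n ↦ ((coeff n (truncGen 0) : ℤ) : ℂ) * q ^ n) 0 ?_ using 1
    · simp [truncGen, eulerProd]
    · intro n hn
      simp [truncGen, coeff_one, hn]
  | succ N ih =>
    have hs : Summable fun n ↦ ((coeff n (truncGen (N + 1)) : ℤ) : ℂ) * q ^ n :=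
      .of_norm_bounded (summable_norm_overpartitionFn hq) fun n ↦ norm_truncGen_le q (N + 1) n
    have e := (ih.add ((hasSum_shift hs.hasSum (N + 1)).add (hasSum_shift ih (N + 1)))).unique
      (a₂ := ∑' n, ((coeff n (truncGen (N + 1)) : ℤ) : ℂ) * q ^ n) <| by
        convert! hs.hasSum using 1
        ext n
        rw [coeff_truncGen_succ N n]
        split_ifs <;> push_cast <;> ring
    convert hs.hasSum using 1
    rw [eulerProd, prod_range_succ, ← eulerProd, ← mul_div_assoc,
      div_eq_iff (one_sub_pow_ne_zero hq N)]
    linear_combination e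

lemma tendsto_eulerProd {q : ℂ} (hq : ‖q‖ < 1) :
    Tendsto (eulerProd q) atTop (𝓝 (∑' n, (overpartitionFn n : ℂ) * q ^ n)) := by
  have : eulerProd q = fun N ↦ ∑' n, ((coeff n (truncGen N) : ℤ) : ℂ) * q ^ n :=
    funext fun N ↦ (hasSum_truncGen hq N).tsum_eq.symm
  rw [this]
  refine tendsto_tsum_of_dominated_convergence (summable_norm_overpartitionFn hq) (fun n ↦ ?_)
    (.of_forall fun N n ↦ norm_truncGen_le q N n)
  refine tendsto_atTop_of_eventually_const (i₀ := n) fun N hN ↦ ?_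
  rw [coeff_truncGen_of_le hN, Int.cast_natCast]

end Overpartition

namespace Overpartition

open Finset Filter Topology

/-- The Pochhammer product `∏_{i ≤ m} (1 - q ^ (2 i))`. -/
noncomputable def sqPoch (q : ℂ) (m : ℕ) : ℂ := ∏ i ∈ range m, (1 - (q ^ 2) ^ (i + 1))

/-- The reciprocal of `sqPoch`, extended by zero to negative indices. -/
noncomputable def invPoch (q : ℂ) (m : ℤ) : ℂ := if 0 ≤ m then (sqPoch q m.toNat)⁻¹ else 0

/-- The `k`-th term of the finite form of the Jacobi triple product, up to normalization. -/
noncomputable def tripleTerm (q : ℂ) (n : ℕ) (k : ℤ) : ℂ :=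
  q ^ (k ^ 2) * invPoch q (n - k) * invPoch q (n + k)

/-- The theta series `∑ (-1) ^ k q ^ (k ^ 2)`. -/
noncomputable def theta (q : ℂ) : ℂ := ∑' k : ℤ, (-1) ^ k * q ^ (k ^ 2)

lemma norm_sq_lt_one {q : ℂ} (hq : ‖q‖ < 1) : ‖q ^ 2‖ < 1 := by
  rw [norm_pow]
  exact pow_lt_one₀ (norm_nonneg _) hq two_ne_zero

lemma invPoch_sub_one {q : ℂ} (hq : ‖q‖ < 1) (m : ℤ) :
    invPoch q (m - 1) = (1 - (q ^ 2) ^ m) * invPoch q m := by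
  rcases lt_trichotomy m 0 with h | rfl | h
  · rw [invPoch, invPoch, if_neg (by omega), if_neg (by omega), mul_zero]
  · simp [invPoch]
  · lift m to ℕ using h.le
    obtain ⟨m, rfl⟩ := Nat.exists_eq_succ_of_ne_zero (show m ≠ 0 by omega)
    rw [invPoch, invPoch, if_pos (by omega), if_pos (by omega)]
    have e : ((m.succ : ℤ) - 1).toNat = m := by omega
    have h1 := one_sub_pow_ne_zero (norm_sq_lt_one hq) m
    rw [e, Int.toNat_natCast, sqPoch, sqPoch, prod_range_succ, zpow_natCast, Nat.succ_eq_add_one,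
      mul_inv, mul_comm, mul_assoc, inv_mul_cancel₀ h1, mul_one]

lemma tripleTerm_succ {q : ℂ} (hq : ‖q‖ < 1) (h0 : q ≠ 0) (n : ℕ) (k : ℤ) :
    (1 - q ^ (4 * n + 4)) * (1 - q ^ (4 * n + 2)) * tripleTerm q (n + 1) k =
      (1 + q ^ (4 * n + 2)) * tripleTerm q n k +
        q ^ (2 * n + 1) * (tripleTerm q n (k - 1) + tripleTerm q n (k + 1)) := by
  set u := invPoch q ((n + 1 : ℕ) - k) with hu
  set v := invPoch q ((n + 1 : ℕ) + k) with hv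
  have e1 : invPoch q (n - k) = (1 - (q ^ 2) ^ ((n : ℤ) + 1 - k)) * u := by
    rw [hu, show ((n : ℤ) - k) = ((n : ℤ) + 1 - k) - 1 by ring, invPoch_sub_one hq]
    push_cast; rfl
  have e2 : invPoch q (n + k) = (1 - (q ^ 2) ^ ((n : ℤ) + 1 + k)) * v := by
    rw [hv, show ((n : ℤ) + k) = ((n : ℤ) + 1 + k) - 1 by ring, invPoch_sub_one hq]
    push_cast; rfl
  have e3 : invPoch q (n - (k + 1)) =
      (1 - (q ^ 2) ^ ((n : ℤ) - k)) * ((1 - (q ^ 2) ^ ((n : ℤ) + 1 - k)) * u) := by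
    rw [← e1, ← invPoch_sub_one hq]
    ring_nf
  have e4 : invPoch q (n + (k - 1)) =
      (1 - (q ^ 2) ^ ((n : ℤ) + k)) * ((1 - (q ^ 2) ^ ((n : ℤ) + 1 + k)) * v) := by
    rw [← e2, ← invPoch_sub_one hq]
    ring_nf
  have e5 : invPoch q (n - (k - 1)) = u := by rw [hu]; push_cast; ring_nf
  have e6 : invPoch q (n + (k + 1)) = v := by rw [hv]; push_cast; ring_nf
  have hsq : (q ^ 2 : ℂ) ≠ 0 := pow_ne_zero _ h0
  have p1 : q ^ ((k - 1) ^ 2) = q ^ (k ^ 2) * q * (q ^ k)⁻¹ ^ 2 := by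
    rw [show (k - 1) ^ 2 = k ^ 2 + 1 - k * 2 by ring, zpow_sub₀ h0, zpow_add₀ h0, zpow_mul]
    simp [div_eq_mul_inv]
  have p2 : q ^ ((k + 1) ^ 2) = q ^ (k ^ 2) * q * (q ^ k) ^ 2 := by
    rw [show (k + 1) ^ 2 = k ^ 2 + 1 + k * 2 by ring, zpow_add₀ h0, zpow_add₀ h0, zpow_mul]
    simp
  have hk : (q ^ 2) ^ k = (q ^ k) ^ 2 := by
    rw [← zpow_natCast, ← zpow_natCast, zpow_comm]
  simp only [tripleTerm, ← hu, ← hv, e1, e2, e3, e4, e5, e6, p1, p2]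
  simp only [zpow_sub₀ hsq, zpow_add₀ hsq, hk, zpow_natCast, zpow_one]
  have ha : q ^ k ≠ 0 := zpow_ne_zero _ h0
  generalize q ^ k = a at *
  generalize q ^ (k ^ 2) = b
  field_simp
  ring

lemma tripleTerm_eq_zero {q : ℂ} {n : ℕ} {k : ℤ} (h : k ∉ Icc (-n : ℤ) n) :
    tripleTerm q n k = 0 := by
  rw [tripleTerm, invPoch, invPoch]
  have : ¬ 0 ≤ (n : ℤ) - k ∨ ¬ 0 ≤ (n : ℤ) + k := by
    rw [mem_Icc] at h
    omega
  rcases this with h | h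
  · rw [if_neg h, mul_zero, zero_mul]
  · rw [if_neg h, mul_zero]

lemma summable_tripleTerm (q : ℂ) (n : ℕ) : Summable fun k : ℤ ↦ (-1) ^ k * tripleTerm q n k :=
  summable_of_ne_finset_zero (s := Icc (-n : ℤ) n) fun k hk ↦ by rw [tripleTerm_eq_zero hk, mul_zero]

lemma tsum_tripleTerm_succ {q : ℂ} (hq : ‖q‖ < 1) (h0 : q ≠ 0) (n : ℕ) :
    (1 - q ^ (4 * n + 4)) * (1 - q ^ (4 * n + 2)) * ∑' k : ℤ, (-1) ^ k * tripleTerm q (n + 1) k =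
      (1 - q ^ (2 * n + 1)) ^ 2 * ∑' k : ℤ, (-1) ^ k * tripleTerm q n k := by
  have h := (summable_tripleTerm q n).hasSum
  have hm := ((Equiv.subRight (1 : ℤ)).hasSum_iff).mpr h
  have hp := ((Equiv.addRight (1 : ℤ)).hasSum_iff).mpr h
  have e := ((h.mul_left (1 + q ^ (4 * n + 2))).sub ((hm.add hp).mul_left (q ^ (2 * n + 1))))
  have e' := (summable_tripleTerm q (n + 1)).hasSum.mul_left
    ((1 - q ^ (4 * n + 4)) * (1 - q ^ (4 * n + 2)))
  rw [e'.unique (a₂ := _) (by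
    convert! e using 1
    ext k
    have := tripleTerm_succ hq h0 n k
    simp only [Function.comp_apply, Equiv.subRight_apply, Equiv.coe_addRight]
    rw [zpow_sub₀ (by simp), zpow_add₀ (by simp)]
    linear_combination (-1) ^ k * this)]
  ring

lemma tsum_tripleTerm_mul_eulerProd {q : ℂ} (hq : ‖q‖ < 1) (h0 : q ≠ 0) (n : ℕ) :
    (∑' k : ℤ, (-1) ^ k * tripleTerm q n k) * sqPoch q n ^ 2 * eulerProd q (2 * n) = 1 := by
  induction n with
  | zero =>
    rw [tsum_eq_single 0]
    · simp [tripleTerm, invPoch, sqPoch, eulerProd]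
    · intro k hk
      rw [tripleTerm_eq_zero (by simpa using hk), mul_zero]
  | succ n ih =>
    have h := tsum_tripleTerm_succ hq h0 n
    refine Eq.trans ?_ ih
    have hs : sqPoch q (n + 1) = sqPoch q n * (1 - (q ^ 2) ^ (n + 1)) := prod_range_succ _ _
    have he : eulerProd q (2 * (n + 1)) = eulerProd q (2 * n) *
        ((1 + q ^ (2 * n + 1)) / (1 - q ^ (2 * n + 1))) *
        ((1 + q ^ (2 * n + 1 + 1)) / (1 - q ^ (2 * n + 1 + 1))) := by
      rw [mul_add_one 2 n, eulerProd, prod_range_succ, prod_range_succ, ← eulerProd]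
    rw [hs, he]
    have a1 := one_sub_pow_ne_zero hq (2 * n)
    have a2 := one_sub_pow_ne_zero hq (2 * n + 1)
    have b1 := one_add_pow_ne_zero hq (2 * n)
    have b2 := one_add_pow_ne_zero hq (2 * n + 1)
    have c1 : 1 - q ^ (4 * n + 4) = (1 - q ^ (2 * n + 1 + 1)) * (1 + q ^ (2 * n + 1 + 1)) := by ring
    have c2 : 1 - q ^ (4 * n + 2) = (1 - q ^ (2 * n + 1)) * (1 + q ^ (2 * n + 1)) := by ring
    have c3 : (q ^ 2) ^ (n + 1) = q ^ (2 * n + 1 + 1) := by ring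
    rw [c1, c2] at h
    rw [c3]
    generalize q ^ (2 * n + 1) = x at *
    generalize q ^ (2 * n + 1 + 1) = y at *
    field_simp
    have h' := mul_left_cancel₀ a1 (by linear_combination h :
      (1 - x) * ((1 - y) * (1 + y) * (1 + x) * ∑' k : ℤ, (-1) ^ k * tripleTerm q (n + 1) k) =
      (1 - x) * ((1 - x) * ∑' k : ℤ, (-1) ^ k * tripleTerm q n k))
    linear_combination (sqPoch q n ^ 2 * eulerProd q (2 * n)) * h'

lemma summable_zpow_sq {q : ℝ} (h0 : 0 ≤ q) (hq : q < 1) : Summable fun k : ℤ ↦ q ^ (k ^ 2) := by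
  have h : Summable fun n : ℕ ↦ q ^ (n ^ 2) :=
    (summable_geometric_of_lt_one h0 hq).of_nonneg_of_le (fun n ↦ by positivity) fun n ↦
      pow_le_pow_of_le_one h0 hq.le (by nlinarith [Nat.le_self_pow two_ne_zero n])
  refine Summable.of_nat_of_neg ?_ ?_
  · exact_mod_cast h
  · simp only [even_two.neg_pow]
    exact_mod_cast h

lemma tendsto_sqPoch_toNat {q L : ℂ} (h : Tendsto (sqPoch q) atTop (𝓝 L)) (k : ℤ) :
    Tendsto (fun n : ℕ ↦ sqPoch q (n + k).toNat) atTop (𝓝 L) := by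
  refine h.comp (tendsto_atTop_atTop.mpr fun b ↦ ⟨b + k.natAbs, fun n hn ↦ ?_⟩)
  omega

lemma tendsto_invPoch {q L : ℂ} (hL : L ≠ 0) (h : Tendsto (sqPoch q) atTop (𝓝 L)) (k : ℤ) :
    Tendsto (fun n : ℕ ↦ invPoch q (n + k)) atTop (𝓝 L⁻¹) := by
  refine ((tendsto_sqPoch_toNat h k).inv₀ hL).congr' ?_
  filter_upwards [eventually_ge_atTop k.natAbs] with n hn
  rw [invPoch, if_pos (by omega)]

lemma tendsto_tsum_tripleTerm {q : ℂ} (hq : ‖q‖ < 1) :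
    Tendsto (fun n ↦ (∑' k : ℤ, (-1) ^ k * tripleTerm q n k) * sqPoch q n ^ 2) atTop
      (𝓝 (theta q)) := by
  obtain ⟨L, hL, h⟩ := exists_tendsto_prod_one_sub (norm_sq_lt_one hq)
  change Tendsto (sqPoch q) atTop (𝓝 L) at h
  obtain ⟨C, hC⟩ := h.norm.bddAbove_range
  obtain ⟨D, hD⟩ := (h.inv₀ hL).norm.bddAbove_range
  have hC' : ∀ n, ‖sqPoch q n‖ ≤ C := fun n ↦ hC ⟨n, rfl⟩
  have hD' : ∀ m, ‖invPoch q m‖ ≤ D := fun m ↦ by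
    rw [invPoch]
    split_ifs
    · exact hD ⟨m.toNat, rfl⟩
    · rw [norm_zero]
      exact (norm_nonneg _).trans (hD ⟨0, rfl⟩)
  have hD0 : 0 ≤ D := (norm_nonneg _).trans (hD' 0)
  simp only [← tsum_mul_right]
  refine tendsto_tsum_of_dominated_convergence (bound := fun k : ℤ ↦ ‖q‖ ^ (k ^ 2) * D * D * C ^ 2)
    ?_ (fun k ↦ ?_) (.of_forall fun n k ↦ ?_)
  · exact (((summable_zpow_sq (norm_nonneg _) hq).mul_right _).mul_right _).mul_right _
  · have := ((tendsto_invPoch hL h (-k)).mul (tendsto_invPoch hL h k)).mul (h.pow 2)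
    rw [show L⁻¹ * L⁻¹ * L ^ 2 = 1 by field_simp] at this
    convert! this.const_mul ((-1) ^ k * q ^ (k ^ 2)) using 1
    · ext n
      simp only [tripleTerm, sub_eq_add_neg]
      ring
    · rw [mul_one]
  · rw [tripleTerm, norm_mul, norm_mul, norm_mul, norm_mul, norm_zpow, norm_zpow, norm_pow, norm_neg,
      norm_one, one_zpow, one_mul]
    gcongr
    exacts [hD' _, hD' _, hC' _]

/-- Gauss's identity for the generating function of the overpartition function. -/
theorem tsum_overpartitionFn_mul_theta {q : ℂ} (hq : ‖q‖ < 1) (h0 : q ≠ 0) :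
    (∑' n, (overpartitionFn n : ℂ) * q ^ n) * theta q = 1 := by
  have h := (tendsto_tsum_tripleTerm hq).mul
    ((tendsto_eulerProd hq).comp (tendsto_id.const_mul_atTop' (two_pos : (0 : ℕ) < 2)))
  rw [mul_comm]
  refine tendsto_nhds_unique h ?_
  simp [tsum_tripleTerm_mul_eulerProd hq h0]

end Overpartition

namespace Overpartition

open Filter Topology Complex
open scoped Real

/-- The generating function of the overpartition function at `q = exp (-π t)`. -/
noncomputable def gen (t : ℂ) : ℂ := ∑' n, (overpartitionFn n : ℂ) * cexp (-π * t) ^ n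

/-- The dual theta series. -/
noncomputable def dualTheta (t : ℂ) : ℂ := ∑' k : ℤ, cexp (-π * (k * (k - 1)) / t)

/-- The main term of `gen` near the real axis. -/
noncomputable def genMain (t : ℂ) : ℂ := t ^ (1 / 2 : ℂ) / 2 * cexp (π / (4 * t))

lemma norm_cexp_neg_pi_mul (t : ℂ) : ‖cexp (-π * t)‖ = Real.exp (-π * t.re) := by
  rw [Complex.norm_exp, ← ofReal_neg, re_ofReal_mul]

lemma norm_cexp_neg_pi_mul_lt_one {t : ℂ} (ht : 0 < t.re) : ‖cexp (-π * t)‖ < 1 := by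
  rw [norm_cexp_neg_pi_mul, Real.exp_lt_one_iff]
  nlinarith [Real.pi_pos]

lemma theta_eq_dualTheta {t : ℂ} (ht : 0 < t.re) :
    theta (cexp (-π * t)) = (t ^ (1 / 2 : ℂ))⁻¹ * cexp (-π / (4 * t)) * dualTheta t := by
  have h0 : t ≠ 0 := by
    rintro rfl
    simp at ht
  have h := jacobiTheta₂_functional_equation (1 / 2) (I * t)
  rw [jacobiTheta₂] at h
  have e : ∀ k : ℤ, jacobiTheta₂_term k (1 / 2) (I * t) = (-1) ^ k * cexp (-π * t) ^ (k ^ 2) := by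
    intro k
    rw [jacobiTheta₂_term, Complex.exp_add, ← Complex.exp_pi_mul_I, ← Complex.exp_int_mul,
      ← Complex.exp_int_mul]
    congr 2
    · ring
    · push_cast
      linear_combination (π * k ^ 2 * t) * I_sq
  rw [theta, ← tsum_congr e, h, jacobiTheta₂, dualTheta]
  have e1 : -I * (I * t) = t := by linear_combination -t * I_sq
  have e2 : -π * I * (1 / 2) ^ 2 / (I * t) = -π / (4 * t) := by
    field_simp
    norm_num
  rw [e1, e2, one_div]
  congr 1
  refine tsum_congr fun k ↦ ?_
  rw [jacobiTheta₂_term]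
  congr 1
  field_simp
  ring

lemma gen_mul_dualTheta {t : ℂ} (ht : 0 < t.re) : gen t * dualTheta t = 2 * genMain t := by
  have h0 : t ≠ 0 := by
    rintro rfl
    simp at ht
  have h := tsum_overpartitionFn_mul_theta (norm_cexp_neg_pi_mul_lt_one ht) (Complex.exp_ne_zero _)
  rw [theta_eq_dualTheta ht, ← gen] at h
  have h1 : t ^ (1 / 2 : ℂ) ≠ 0 := by simp [cpow_eq_zero_iff, h0]
  have h2 : cexp (π / (4 * t)) * cexp (-π / (4 * t)) = 1 := by
    rw [← Complex.exp_add, ← add_div, add_neg_cancel, zero_div, Complex.exp_zero]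
  rw [genMain]
  have h3 : t ^ (1 / 2 : ℂ) * (t ^ (1 / 2 : ℂ))⁻¹ = 1 := mul_inv_cancel₀ h1
  linear_combination (t ^ (1 / 2 : ℂ) * cexp (π / (4 * t))) * h - gen t * dualTheta t * h2 -
    gen t * dualTheta t * cexp (π / (4 * t)) * cexp (-π / (4 * t)) * h3

lemma norm_dualTheta_term {t : ℂ} (k : ℝ) :
    ‖cexp (-π * k / t)‖ = Real.exp (-π * k * (t⁻¹).re) := by
  rw [Complex.norm_exp, div_eq_mul_inv, ← ofReal_neg, ← ofReal_mul, re_ofReal_mul]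

lemma dualTheta_tail_le {t : ℂ} (n : ℕ) (ht : 0 ≤ (t⁻¹).re) :
    ‖cexp (-π * ((n + 1 : ℕ) * ((n + 1 : ℕ) + 1)) / t)‖ ≤
      Real.exp (-(2 * π * (t⁻¹).re)) * Real.exp (-(2 * π * (t⁻¹).re)) ^ n := by
  have := norm_dualTheta_term (t := t) ((n + 1 : ℕ) * ((n + 1 : ℕ) + 1))
  push_cast at this ⊢
  rw [this, ← pow_succ', ← Real.exp_nat_mul, Real.exp_le_exp]
  push_cast
  have : 0 ≤ π * (t⁻¹).re * (n * (n + 1)) := by positivity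
  nlinarith

lemma re_inv_pos {t : ℂ} (ht : 0 < t.re) : 0 < (t⁻¹).re := by
  rw [inv_re]
  exact div_pos ht (normSq_pos.mpr fun h ↦ by simp [h] at ht)

lemma summable_dualTheta_tail {t : ℂ} (ht : 0 < t.re) :
    Summable fun n : ℕ ↦ cexp (-π * ((n + 1 : ℕ) * ((n + 1 : ℕ) + 1)) / t) := by
  have h := re_inv_pos ht
  refine Summable.of_norm_bounded ((summable_geometric_of_lt_one (Real.exp_pos _).le ?_).mul_left _)
    fun n ↦ dualTheta_tail_le n h.le
  rw [Real.exp_lt_one_iff]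
  nlinarith [mul_pos Real.pi_pos h]

lemma dualTheta_eq {t : ℂ} (ht : 0 < t.re) :
    dualTheta t = 2 + 2 * ∑' n : ℕ, cexp (-π * ((n + 1 : ℕ) * ((n + 1 : ℕ) + 1)) / t) := by
  have h := (summable_dualTheta_tail ht).hasSum
  have h1 := (hasSum_nat_add_iff (f := fun n : ℕ ↦ cexp (-π * (n * (n + 1)) / t)) 1).mp h
  have h2 := HasSum.of_nat_of_neg_add_one (f := fun k : ℤ ↦ cexp (-π * (k * (k + 1)) / t))
    (by simpa only [Int.cast_natCast] using h1) (by
      convert! h1 using 3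
      push_cast
      ring)
  have h3 := ((Equiv.subRight (1 : ℤ)).hasSum_iff).mpr h2
  rw [dualTheta]
  convert! h3.tsum_eq using 1
  · refine tsum_congr fun k ↦ ?_
    simp [mul_comm]
  · simp
    ring

lemma norm_dualTheta_sub_two_le {t : ℂ} (ht : 0 < t.re)
    (hy : Real.exp (-(2 * π * (t⁻¹).re)) ≤ 1 / 2) :
    ‖dualTheta t - 2‖ ≤ 4 * Real.exp (-(2 * π * (t⁻¹).re)) := by
  set y := Real.exp (-(2 * π * (t⁻¹).re)) with hydef
  have h := re_inv_pos ht
  have hy0 : 0 < y := Real.exp_pos _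
  have hs := tsum_of_norm_bounded ((hasSum_geometric_of_lt_one hy0.le (by linarith)).mul_left y)
    fun n ↦ dualTheta_tail_le n h.le
  rw [dualTheta_eq ht, add_sub_cancel_left, norm_mul, Complex.norm_ofNat]
  have : y * (1 - y)⁻¹ ≤ 2 * y := by
    rw [mul_comm]
    gcongr
    rw [inv_le_comm₀] <;> linarith
  linarith

lemma norm_gen_sub_genMain_le {t : ℂ} (ht : 0 < t.re)
    (hy : Real.exp (-(2 * π * (t⁻¹).re)) ≤ 1 / 4) :
    ‖gen t - genMain t‖ ≤ 4 * Real.exp (-(2 * π * (t⁻¹).re)) * ‖genMain t‖ := by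
  have h1 := norm_dualTheta_sub_two_le ht (by linarith)
  have h2 := gen_mul_dualTheta ht
  have h3 : ‖(gen t - genMain t) * dualTheta t‖ = ‖genMain t‖ * ‖dualTheta t - 2‖ := by
    rw [← norm_neg, ← norm_mul]
    congr 1
    linear_combination -h2
  have h4 : 1 ≤ ‖dualTheta t‖ := by
    have := norm_sub_norm_le (2 : ℂ) (2 - dualTheta t)
    rw [sub_sub_cancel, norm_sub_rev 2, Complex.norm_ofNat] at this
    linarith
  rw [norm_mul] at h3
  nlinarith [norm_nonneg (gen t - genMain t), norm_nonneg (genMain t)]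

lemma gen_ofReal (r : ℝ) :
    gen r = (∑' n, (overpartitionFn n : ℝ) * Real.exp (-π * r) ^ n : ℝ) := by
  rw [gen, ofReal_tsum]
  push_cast
  rfl

lemma tsum_overpartitionFn_le {r : ℝ} (hr : 0 < r) :
    ∑' n, (overpartitionFn n : ℝ) * Real.exp (-π * r) ^ n ≤ √r / 2 * Real.exp (π / (4 * r)) := by
  have h := gen_mul_dualTheta (t := r) (by simpa)
  have e : ∀ n : ℕ, cexp (-π * ((n + 1 : ℕ) * ((n + 1 : ℕ) + 1)) / r) =
      (Real.exp (-π * ((n + 1 : ℕ) * ((n + 1 : ℕ) + 1)) / r) : ℝ) := fun n ↦ by push_cast; rfl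
  rw [dualTheta_eq (by simpa), tsum_congr e, ← ofReal_tsum, gen_ofReal, genMain,
    show (1 / 2 : ℂ) = (1 / 2 : ℝ) by norm_num, ← ofReal_cpow hr.le, ← Real.sqrt_eq_rpow] at h
  have h5 : (∑' n, (overpartitionFn n : ℝ) * Real.exp (-π * r) ^ n) * (2 + 2 *
      ∑' n : ℕ, Real.exp (-π * ((n + 1 : ℕ) * ((n + 1 : ℕ) + 1)) / r)) =
      2 * (√r / 2 * Real.exp (π / (4 * r))) := by
    exact_mod_cast h
  have h6 : 0 ≤ ∑' n, (overpartitionFn n : ℝ) * Real.exp (-π * r) ^ n :=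
    tsum_nonneg fun n ↦ by positivity
  have h7 : 0 ≤ ∑' n : ℕ, Real.exp (-π * ((n + 1 : ℕ) * ((n + 1 : ℕ) + 1)) / r) :=
    tsum_nonneg fun n ↦ by positivity
  nlinarith

end Overpartition

namespace Overpartition

open Filter Topology Complex Finset
open scoped Real

lemma hasSum_log_norm_one_add_div_one_sub {w : ℂ} (hw : ‖w‖ < 1) :
    HasSum (fun n : ℕ ↦ (((-1) ^ (n + 1) + 1) / n : ℝ) * (w ^ n).re)
      (Real.log (‖1 + w‖ / ‖1 - w‖)) := by
  have h := Complex.hasSum_re ((hasSum_taylorSeries_log hw).add (hasSum_taylorSeries_neg_log hw))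
  have h1 : 1 + w ≠ 0 := by simpa using one_add_pow_ne_zero hw 0
  have h2 : 1 - w ≠ 0 := by simpa using one_sub_pow_ne_zero hw 0
  rw [Real.log_div (norm_ne_zero_iff.mpr h1) (norm_ne_zero_iff.mpr h2)]
  convert! h using 2 with n
  · rw [← re_ofReal_mul]
    push_cast
    ring_nf
  · rw [add_re, neg_re, log_re, log_re, sub_eq_add_neg]

lemma norm_one_add_div_one_sub_le {w : ℂ} (hw : ‖w‖ < 1) :
    ‖(1 + w) / (1 - w)‖ ≤ (1 + ‖w‖) / (1 - ‖w‖) * Real.exp (-2 * (‖w‖ - w.re)) := by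
  have h := hasSum_log_norm_one_add_div_one_sub hw
  have h' := hasSum_log_norm_one_add_div_one_sub (w := (‖w‖ : ℂ)) (by simpa)
  have h0 := norm_nonneg w
  have hle := hasSum_le (f := fun n ↦ if n = 1 then 2 * (‖w‖ - w.re) else 0) (fun n ↦ ?_)
    (hasSum_ite_eq 1 _) (h'.sub h)
  rotate_left
  · rw [← mul_sub]
    have hre : 0 ≤ ((‖w‖ : ℂ) ^ n).re - (w ^ n).re := by
      rw [← ofReal_pow, ofReal_re, ← norm_pow, sub_nonneg]
      exact re_le_norm _
    split_ifs with hn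
    · subst hn
      norm_num
    · refine mul_nonneg (div_nonneg ?_ n.cast_nonneg) hre
      rcases neg_one_pow_eq_or ℝ (n + 1) with h | h <;> rw [h] <;> norm_num
  have h1 : 1 + w ≠ 0 := by simpa using one_add_pow_ne_zero hw 0
  have h2 : 1 - w ≠ 0 := by simpa using one_sub_pow_ne_zero hw 0
  have e1 : ‖1 + (‖w‖ : ℂ)‖ = 1 + ‖w‖ := by
    rw [← ofReal_one, ← ofReal_add, Complex.norm_real, Real.norm_of_nonneg (by linarith)]
  have e2 : ‖1 - (‖w‖ : ℂ)‖ = 1 - ‖w‖ := by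
    rw [← ofReal_one, ← ofReal_sub, Complex.norm_real, Real.norm_of_nonneg (by linarith)]
  rw [e1, e2] at hle
  have hp : 0 < (1 + ‖w‖) / (1 - ‖w‖) := div_pos (by linarith) (by linarith)
  have hp' : 0 < ‖1 + w‖ / ‖1 - w‖ := div_pos (norm_pos_iff.mpr h1) (norm_pos_iff.mpr h2)
  rw [norm_div, ← Real.exp_log hp, ← Real.exp_log hp', ← Real.exp_add, Real.exp_le_exp]
  linarith

lemma norm_eulerProd_le {q : ℂ} (hq : ‖q‖ < 1) (N : ℕ) :
    ‖eulerProd q N‖ ≤ eulerProd ‖q‖ N *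
      Real.exp (-2 * ∑ i ∈ range N, (‖q‖ ^ (i + 1) - (q ^ (i + 1)).re)) := by
  rw [eulerProd, eulerProd, norm_prod, mul_sum, Real.exp_sum, ← prod_mul_distrib]
  refine prod_le_prod (fun _ _ ↦ norm_nonneg _) fun i _ ↦ ?_
  have h : ‖q ^ (i + 1)‖ < 1 := by
    rw [norm_pow]
    exact pow_lt_one₀ (norm_nonneg _) hq (by omega)
  simpa using norm_one_add_div_one_sub_le h

lemma hasSum_pow_succ {𝕜 : Type*} [RCLike 𝕜] {q : 𝕜} (hq : ‖q‖ < 1) :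
    HasSum (fun i : ℕ ↦ q ^ (i + 1)) ((1 - q)⁻¹ - 1) := by
  rw [hasSum_nat_add_iff (f := fun i ↦ q ^ i) 1]
  simpa using hasSum_geometric_of_norm_lt_one hq

lemma norm_tsum_overpartitionFn_le {q : ℂ} (hq : ‖q‖ < 1) :
    ‖∑' n, (overpartitionFn n : ℂ) * q ^ n‖ ≤ (∑' n, (overpartitionFn n : ℝ) * ‖q‖ ^ n) *
      Real.exp (-2 * ((1 - ‖q‖)⁻¹ - ‖1 - q‖⁻¹)) := by
  have hq' : ‖(‖q‖ : ℝ)‖ < 1 := by simpa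
  have h1 := (tendsto_eulerProd hq).norm
  have h2 : Tendsto (eulerProd ‖q‖) atTop (𝓝 (∑' n, (overpartitionFn n : ℝ) * ‖q‖ ^ n)) := by
    have := (continuous_re.tendsto _).comp (tendsto_eulerProd (q := (‖q‖ : ℂ)) (by simpa))
    convert! this using 2
    · ext N
      simp [eulerProd_ofReal]
    · rw [← ofReal_re (∑' n, (overpartitionFn n : ℝ) * ‖q‖ ^ n), ofReal_tsum]
      push_cast
      rfl
  have h3 := ((hasSum_pow_succ hq').sub (hasSum_re (hasSum_pow_succ hq))).tendsto_sum_nat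
  have h4 := h2.mul ((Real.continuous_exp.tendsto _).comp (h3.const_mul (-2)))
  refine (le_of_tendsto_of_tendsto' h1 h4 fun N ↦ norm_eulerProd_le hq N).trans ?_
  gcongr ?_ * Real.exp ?_
  have := re_le_norm (1 - q)⁻¹
  rw [norm_inv] at this
  simp only [sub_re, one_re]
  linarith

lemma normSq_one_sub_exp_mul_exp (b x : ℝ) :
    ‖1 - cexp (-(b + x * I))‖ ^ 2 =
      (1 - Real.exp (-b)) ^ 2 + 2 * Real.exp (-b) * (1 - Real.cos x) := by
  rw [← normSq_eq_norm_sq, normSq_apply, sub_re, sub_im, exp_re, exp_im]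
  simp
  linear_combination Real.exp (-b) ^ 2 * Real.cos_sq_add_sin_sq x

lemma norm_one_sub_exp_ge {b x : ℝ} (hb : 0 < b) (hb1 : b ≤ 1 / 60) (hx : 2 * b ≤ |x|)
    (hx1 : |x| ≤ π) :
    11 / 5 * (1 - Real.exp (-b)) ≤ ‖1 - cexp (-(b + x * I))‖ := by
  have h1 : Real.cos x ≤ Real.cos (2 * b) := by
    rw [← Real.cos_abs x]
    exact Real.cos_le_cos_of_nonneg_of_le_pi (by linarith) hx1 hx
  have h2 := (abs_le.mp (Real.cos_bound (x := 2 * b) (by rw [abs_of_pos] <;> linarith))).2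
  rw [abs_of_pos (by linarith)] at h2
  have h3 := Real.add_one_le_exp (-b)
  have h4 : Real.exp (-b) < 1 := by simpa
  refine le_of_sq_le_sq ?_ (norm_nonneg _)
  rw [normSq_one_sub_exp_mul_exp]
  set ρ := Real.exp (-b)
  have h5 : (1 - ρ) ^ 2 ≤ b ^ 2 := by
    gcongr
    linarith
  have h6 : b ^ 4 ≤ b ^ 2 / 3600 := by
    have : b ^ 2 ≤ (1 / 60) ^ 2 := by gcongr
    nlinarith [sq_nonneg b]
  have h7 : 199 / 100 * b ^ 2 ≤ 1 - Real.cos x := by nlinarith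
  have h8 : 2 * (59 / 60) * (199 / 100 * b ^ 2) ≤ 2 * ρ * (1 - Real.cos x) := by
    gcongr
    linarith
  nlinarith

lemma norm_gen_le {r y : ℝ} (hr : 0 < r) (hr1 : r ≤ 1 / 200) (hy : 2 * r ≤ |y|) (hy1 : |y| ≤ 1) :
    ‖gen (r + y * I)‖ ≤ √r / 2 * Real.exp (π / (4 * r)) * Real.exp (-(109 / 100) / (π * r)) := by
  have hre : (r + y * I : ℂ).re = r := by simp
  have hq := norm_cexp_neg_pi_mul_lt_one (t := r + y * I) (by rwa [hre])
  have hq' := norm_cexp_neg_pi_mul (r + y * I)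
  refine (norm_tsum_overpartitionFn_le hq).trans ?_
  rw [hq', hre]
  have hpi := Real.pi_pos
  have hpi' := Real.pi_lt_d2
  have hb : 0 < π * r := by positivity
  have h := norm_one_sub_exp_ge (b := π * r) (x := π * y) hb (by nlinarith)
    (by rw [abs_mul, abs_of_pos hpi]; nlinarith) (by rw [abs_mul, abs_of_pos hpi]; nlinarith)
  have e : -(((π * r : ℝ) : ℂ) + ((π * y : ℝ) : ℂ) * I) = -π * (r + y * I) := by
    push_cast
    ring
  rw [e, ← neg_mul] at h
  have h3 := Real.add_one_le_exp (-π * r)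
  have h4 : Real.exp (-π * r) < 1 := by
    rw [Real.exp_lt_one_iff]
    linarith
  gcongr ?_ * Real.exp ?_
  · exact tsum_overpartitionFn_le hr
  · have h5 : ‖1 - cexp (-π * (r + y * I))‖⁻¹ ≤ (11 / 5 * (1 - Real.exp (-π * r)))⁻¹ :=
      inv_anti₀ (by linarith) h
    have h6 : (π * r)⁻¹ ≤ (1 - Real.exp (-π * r))⁻¹ := inv_anti₀ (by linarith) (by linarith)
    rw [mul_inv] at h5
    rw [neg_div, div_eq_mul_inv]
    have : 0 < (π * r)⁻¹ := by positivity
    linarith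

end Overpartition

namespace Overpartition

open Filter Topology Complex MeasureTheory
open scoped Real

/-- The variable `exp (π t)` on the vertical line `t = r + y i`. -/
noncomputable def nome (r y : ℝ) : ℂ := cexp (π * (r + y * I))

/-- The generating function on the vertical line `t = r + y i`. -/
noncomputable def genLine (r y : ℝ) : ℂ := gen (r + y * I)

lemma continuous_nome (r : ℝ) : Continuous (nome r) := by
  unfold nome
  fun_prop

lemma norm_nome (r y : ℝ) : ‖nome r y‖ = Real.exp (π * r) := by
  rw [nome, Complex.norm_exp, re_ofReal_mul]
  simp

lemma integral_exp_pi_int_mul (k : ℤ) :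
    ∫ y in (-1 : ℝ)..1, cexp (k * π * I * y) = if k = 0 then 2 else 0 := by
  split_ifs with h
  · subst h
    simp
    norm_num
  · have hk : (k * π * I : ℂ) ≠ 0 := by simp [h, Real.pi_ne_zero]
    rw [integral_exp_mul_complex hk, div_eq_zero_iff, sub_eq_zero]
    refine Or.inl (Complex.exp_eq_exp_iff_exists_int.mpr ⟨k, ?_⟩)
    push_cast
    ring

lemma gen_term_eq (n m : ℕ) (r y : ℝ) :
    nome r y ^ n * ((overpartitionFn m : ℂ) * cexp (-π * (r + y * I)) ^ m) =
      (overpartitionFn m * cexp ((n - m : ℤ) * π * r)) * cexp ((n - m : ℤ) * π * I * y) := by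
  have : nome r y ^ n * cexp (-π * (r + y * I)) ^ m =
      cexp ((n - m : ℤ) * π * r) * cexp ((n - m : ℤ) * π * I * y) := by
    rw [nome, ← Complex.exp_nat_mul, ← Complex.exp_nat_mul, ← Complex.exp_add, ← Complex.exp_add]
    congr 1
    push_cast
    ring
  linear_combination (overpartitionFn m : ℂ) * this

lemma summable_gen_line {r : ℝ} (hr : 0 < r) (y : ℝ) :
    Summable fun m ↦ (overpartitionFn m : ℂ) * cexp (-π * (r + y * I)) ^ m :=
  (summable_norm_overpartitionFn (norm_cexp_neg_pi_mul_lt_one (by simpa))).of_norm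

lemma norm_gen_line_term {r : ℝ} (m : ℕ) (y : ℝ) :
    ‖(overpartitionFn m : ℂ) * cexp (-π * (r + y * I)) ^ m‖ =
      ‖(overpartitionFn m : ℂ) * cexp (-π * r) ^ m‖ := by
  rw [norm_mul, norm_mul, norm_pow, norm_pow, norm_cexp_neg_pi_mul, norm_cexp_neg_pi_mul]
  simp

lemma continuous_genLine {r : ℝ} (hr : 0 < r) : Continuous (genLine r) := by
  unfold genLine gen
  refine continuous_tsum (fun m ↦ by fun_prop)
    (summable_norm_overpartitionFn (norm_cexp_neg_pi_mul_lt_one (t := r) (by simpa))) fun m y ↦ ?_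
  exact (norm_gen_line_term m y).le

lemma integral_nome_pow_mul_genLine {r : ℝ} (hr : 0 < r) (n : ℕ) :
    ∫ y in (-1 : ℝ)..1, nome r y ^ n * genLine r y = 2 * overpartitionFn n := by
  have h := intervalIntegral.hasSum_integral_of_dominated_convergence (a := -1) (b := 1)
    (μ := volume)
    (F := fun (m : ℕ) (y : ℝ) ↦
      nome r y ^ n * ((overpartitionFn m : ℂ) * cexp (-π * (r + y * I)) ^ m))
    (f := fun y ↦ nome r y ^ n * genLine r y)
    (fun m _ ↦ Real.exp (π * r) ^ n * ‖(overpartitionFn m : ℂ) * cexp (-π * r) ^ m‖)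
    (fun m ↦ (((continuous_nome r).pow n).mul (by fun_prop)).aestronglyMeasurable)
    (fun m ↦ ae_of_all _ fun y _ ↦ by
      rw [norm_mul, norm_pow, norm_nome, norm_gen_line_term])
    (ae_of_all _ fun y _ ↦ (summable_norm_overpartitionFn
      (norm_cexp_neg_pi_mul_lt_one (t := r) (by simpa))).mul_left _)
    intervalIntegrable_const
    (ae_of_all _ fun y _ ↦ (summable_gen_line hr y).hasSum.mul_left _)
  refine h.unique ?_
  simp only [gen_term_eq, intervalIntegral.integral_const_mul, integral_exp_pi_int_mul]
  convert! hasSum_ite_eq n (2 * (overpartitionFn n : ℂ)) using 2 with m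
  by_cases hm : m = n
  · subst hm
    simp [mul_comm]
  · rw [if_neg (by omega), if_neg hm, mul_zero]

/-- The operator `F ↦ F (· + 1) - a F`. -/
def shiftSub (a : ℝ) (F : ℕ → ℝ) (n : ℕ) : ℝ := F (n + 1) - a * F n

/-- `w` represents the sequence `F` by integrals along a vertical line. -/
def Represents (r : ℝ) (w : ℝ → ℂ) (F : ℕ → ℝ) : Prop :=
  Continuous w ∧ ∀ n, ∫ y in (-1 : ℝ)..1, w y * nome r y ^ n * genLine r y = 2 * F n

lemma Represents.shiftSub {r : ℝ} (hr : 0 < r) {w : ℝ → ℂ} {F : ℕ → ℝ} (h : Represents r w F)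
    (a : ℝ) : Represents r (fun y ↦ w y * (nome r y - a)) (shiftSub a F) := by
  have hz := continuous_nome r
  have hg := continuous_genLine hr
  have hw := h.1
  refine ⟨by fun_prop, fun n ↦ ?_⟩
  have e : ∀ y, w y * (nome r y - a) * nome r y ^ n * genLine r y =
      w y * nome r y ^ (n + 1) * genLine r y - a * (w y * nome r y ^ n * genLine r y) := fun y ↦ by
    ring
  simp only [e]
  rw [intervalIntegral.integral_sub, intervalIntegral.integral_const_mul, h.2, h.2,
    Overpartition.shiftSub]
  · push_cast
    ring
  all_goals
    apply Continuous.intervalIntegrable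
    fun_prop

lemma represents_iterate {r : ℝ} (hr : 0 < r) (a : ℝ) (k : ℕ) :
    Represents r (fun y ↦ (nome r y - 1) * (nome r y - a) ^ k)
      ((shiftSub a)^[k] fun n ↦ (dPbar n : ℝ)) := by
  induction k with
  | zero =>
    have h : Represents r (fun _ ↦ 1) (fun n ↦ (overpartitionFn n : ℝ)) :=
      ⟨continuous_const, fun n ↦ by simp [integral_nome_pow_mul_genLine hr]⟩
    convert! h.shiftSub hr 1 using 1
    · ext y
      simp
    · ext n
      simp [dPbar, shiftSub]
  | succ k ih =>
    rw [Function.iterate_succ_apply']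
    convert! ih.shiftSub hr a using 1
    ext y
    ring

lemma laguerre_eq_shiftSub (a : ℝ) (F : ℕ → ℝ) (n : ℕ) :
    3 * F (n + 2) ^ 2 - 4 * F (n + 1) * F (n + 3) + F n * F (n + 4) =
      3 * (shiftSub a)^[2] F n ^ 2 - 4 * (shiftSub a)^[1] F n * (shiftSub a)^[3] F n +
        (shiftSub a)^[0] F n * (shiftSub a)^[4] F n := by
  simp only [Function.iterate_succ, Function.iterate_zero, Function.comp_apply, id, shiftSub]
  ring

lemma cpow_half_sq (t : ℂ) : (t ^ (1 / 2 : ℂ)) ^ 2 = t := by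
  rw [one_div, Complex.cpow_ofNat_inv_pow]

lemma cpow_half_re_nonneg (t : ℂ) : 0 ≤ (t ^ (1 / 2 : ℂ)).re := by
  rcases eq_or_ne t 0 with rfl | h
  · simp
  · rw [cpow_def_of_ne_zero h, exp_re]
    have h1 := neg_pi_lt_arg t
    have h2 := arg_le_pi t
    have e : (Complex.log t * (1 / 2)).im = arg t / 2 := by
      rw [← log_im, show (1 / 2 : ℂ) = ((1 / 2 : ℝ) : ℂ) by norm_num, im_mul_ofReal]
      ring
    rw [e]
    exact mul_nonneg (Real.exp_pos _).le (Real.cos_nonneg_of_mem_Icc ⟨by linarith, by linarith⟩)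

/-- The normalized square root of `t = r (1 + u i)`. -/
noncomputable def sqrtFactor (r u : ℝ) : ℂ := (r + (r * u : ℝ) * I : ℂ) ^ (1 / 2 : ℂ) / √r

lemma sqrtFactor_sq {r : ℝ} (hr : 0 < r) (u : ℝ) : sqrtFactor r u ^ 2 = 1 + u * I := by
  have h : (√r : ℂ) ^ 2 = r := by exact_mod_cast Real.sq_sqrt hr.le
  have hr' : (r : ℂ) ≠ 0 := by exact_mod_cast hr.ne'
  rw [sqrtFactor, div_pow, cpow_half_sq, h]
  push_cast
  field_simp

lemma one_le_sqrtFactor_re {r : ℝ} (hr : 0 < r) (u : ℝ) : 1 ≤ (sqrtFactor r u).re := by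
  have h1 : 0 ≤ (sqrtFactor r u).re := by
    rw [sqrtFactor, div_ofReal_re]
    exact div_nonneg (cpow_half_re_nonneg _) (Real.sqrt_nonneg _)
  have h2 := congrArg Complex.re (sqrtFactor_sq hr u)
  rw [pow_two, mul_re] at h2
  simp at h2
  nlinarith [sq_nonneg (sqrtFactor r u).im]

lemma one_le_norm_sqrtFactor {r : ℝ} (hr : 0 < r) (u : ℝ) : 1 ≤ ‖sqrtFactor r u‖ :=
  (one_le_sqrtFactor_re hr u).trans (re_le_norm _)

lemma norm_sqrtFactor_sub_one_le {r : ℝ} (hr : 0 < r) (u : ℝ) :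
    ‖sqrtFactor r u - 1‖ ≤ |u| / 2 := by
  have h1 : ‖(sqrtFactor r u - 1) * (sqrtFactor r u + 1)‖ = |u| := by
    rw [show (sqrtFactor r u - 1) * (sqrtFactor r u + 1) = u * I by
      linear_combination sqrtFactor_sq hr u, norm_mul, norm_I, mul_one, norm_real, Real.norm_eq_abs]
  have h2 : 2 ≤ ‖sqrtFactor r u + 1‖ := by
    refine le_trans ?_ (re_le_norm _)
    rw [add_re, one_re]
    linarith [one_le_sqrtFactor_re hr u]
  rw [norm_mul] at h1
  nlinarith [norm_nonneg (sqrtFactor r u - 1)]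

lemma norm_sqrtFactor_pow {r : ℝ} (hr : 0 < r) (u : ℝ) : ‖sqrtFactor r u‖ ^ 4 = 1 + u ^ 2 := by
  rw [← norm_pow, show 4 = 2 * 2 from rfl, pow_mul, sqrtFactor_sq hr, norm_pow,
    ← normSq_eq_norm_sq, normSq_apply]
  simp
  ring

lemma nome_mul (r u : ℝ) :
    nome r (r * u) = Real.exp (π * r) * cexp ((π * r * u : ℝ) * I) := by
  rw [nome, ofReal_exp, ← Complex.exp_add]
  push_cast
  ring_nf

lemma norm_exp_mul_I_sub_one_le (x : ℝ) : ‖cexp (x * I) - 1‖ ≤ |x| := by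
  simpa [mul_comm] using Real.norm_exp_I_mul_ofReal_sub_one_le (x := x)

/-- The value at `u = 0` of the non-oscillating part of the integrand. -/
noncomputable def ampZero (r : ℝ) : ℝ := (Real.exp (π * r) - 1) / (π * r)

lemma one_le_ampZero {r : ℝ} (hr : 0 < r) : 1 ≤ ampZero r := by
  rw [ampZero, one_le_div (by positivity)]
  linarith [Real.add_one_le_exp (π * r)]

lemma exp_pi_mul_le {r : ℝ} (hr : 0 < r) (hr1 : r ≤ 1 / 200) :
    Real.exp (π * r) - 1 ≤ 1.008 * (π * r) := by
  have hb : 0 < π * r := by positivity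
  have hb1 : π * r ≤ 3.15 / 200 := by nlinarith [Real.pi_lt_d2]
  have h := Real.norm_exp_sub_one_sub_id_le (x := π * r) (by rw [Real.norm_of_nonneg] <;> linarith)
  have h' := Real.exp_bound' hb.le (by linarith) (n := 3) (by norm_num)
  norm_num [Finset.sum_range_succ, Nat.factorial] at h'
  nlinarith [mul_pos hb hb, mul_pos (mul_pos hb hb) hb]

lemma exp_pi_mul_le' {r : ℝ} (hr : 0 < r) (hr1 : r ≤ 1 / 200) : Real.exp (π * r) ≤ 1.016 := by
  have := exp_pi_mul_le hr hr1
  nlinarith [Real.pi_lt_d2]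

lemma ampZero_le {r : ℝ} (hr : 0 < r) (hr1 : r ≤ 1 / 200) : ampZero r ≤ 1.008 := by
  rw [ampZero, div_le_iff₀ (by positivity)]
  exact exp_pi_mul_le hr hr1

lemma norm_nome_sub_one_div_sub_le {r : ℝ} (hr : 0 < r) (hr1 : r ≤ 1 / 200) (u : ℝ) :
    ‖(nome r (r * u) - 1) / (π * r : ℝ) - ampZero r‖ ≤ 1.016 * |u| := by
  have hb : 0 < π * r := by positivity
  have h1 : (nome r (r * u) - 1) / (π * r : ℝ) - ampZero r =
      (Real.exp (π * r) / (π * r) : ℝ) * (cexp ((π * r * u : ℝ) * I) - 1) := by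
    rw [nome_mul, ampZero]
    push_cast
    ring
  rw [h1, norm_mul, norm_real, Real.norm_of_nonneg (by positivity), div_mul_eq_mul_div,
    div_le_iff₀ hb]
  have h2 := norm_exp_mul_I_sub_one_le (π * r * u)
  rw [abs_mul, abs_of_pos hb] at h2
  calc _ ≤ 1.016 * (π * r * |u|) := by
        gcongr
        exact exp_pi_mul_le' hr hr1
    _ = _ := by ring

lemma norm_nome_sub_one_div_le {r : ℝ} (hr : 0 < r) (hr1 : r ≤ 1 / 200) (u : ℝ) :
    ‖(nome r (r * u) - 1) / (π * r : ℝ)‖ ≤ 1.008 + 1.016 * |u| := by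
  have h1 := norm_nome_sub_one_div_sub_le hr hr1 u
  have h2 := norm_le_norm_add_norm_sub' ((nome r (r * u) - 1) / (π * r : ℝ)) (ampZero r : ℂ)
  rw [norm_real, Real.norm_of_nonneg (by linarith [one_le_ampZero hr])] at h2
  linarith [ampZero_le hr hr1]

lemma ampZero_le_norm {r : ℝ} (hr : 0 < r) (y : ℝ) :
    ampZero r ≤ ‖(nome r y - 1) / (π * r : ℝ)‖ := by
  have hb : 0 < π * r := by positivity
  rw [norm_div, norm_real, Real.norm_of_nonneg hb.le, ampZero]
  gcongr
  have := norm_sub_norm_le (nome r y) 1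
  rwa [norm_nome, norm_one] at this

/-- The complex amplitude of the normalized integrand. -/
noncomputable def amp (r : ℝ) (k : ℕ) (u : ℝ) : ℂ :=
  sqrtFactor r u * ((nome r (r * u) - 1) / (π * r : ℝ)) * cexp ((k * (π * r * u / 2) : ℝ) * I) *
    cexp ((π / (4 * r) * (u ^ 3 / (1 + u ^ 2)) : ℝ) * I)

lemma norm_amp (r : ℝ) (k : ℕ) (u : ℝ) :
    ‖amp r k u‖ = ‖sqrtFactor r u‖ * ‖(nome r (r * u) - 1) / (π * r : ℝ)‖ := by
  rw [amp, norm_mul, norm_mul, norm_exp_ofReal_mul_I, norm_exp_ofReal_mul_I, mul_one, mul_one,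
    norm_mul]

lemma ampZero_le_norm_amp {r : ℝ} (hr : 0 < r) (k : ℕ) (u : ℝ) : ampZero r ≤ ‖amp r k u‖ := by
  rw [norm_amp]
  nlinarith [ampZero_le_norm hr (r * u), one_le_norm_sqrtFactor hr u, one_le_ampZero hr]

lemma norm_amp_sub_le {r : ℝ} (hr : 0 < r) (hr1 : r ≤ 1 / 200) {k : ℕ} (hk : k ≤ 4) {u : ℝ}
    (hu : |u| ≤ 0.35) :
    ‖amp r k u - ampZero r‖ ≤ 1.73 * |u| + 1.008 * (π / (4 * r)) * |u| ^ 3 := by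
  have hb : 0 < π * r := by positivity
  have hb1 : π * r ≤ 0.0158 := by nlinarith [Real.pi_lt_d2]
  have hu0 := abs_nonneg u
  set B : ℂ := (nome r (r * u) - 1) / (π * r : ℝ) with hB
  set S := sqrtFactor r u
  set E := cexp ((k * (π * r * u / 2) : ℝ) * I)
  set H := cexp ((π / (4 * r) * (u ^ 3 / (1 + u ^ 2)) : ℝ) * I)
  have e : amp r k u - ampZero r = (S - 1) * B * E * H + (B - ampZero r) * E * H +
      ampZero r * (E - 1) * H + ampZero r * (H - 1) := by
    rw [amp]
    ring
  have hE : ‖E‖ = 1 := norm_exp_ofReal_mul_I _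
  have hH : ‖H‖ = 1 := norm_exp_ofReal_mul_I _
  have hE1 : ‖E - 1‖ ≤ 0.0316 * |u| := by
    refine (norm_exp_mul_I_sub_one_le _).trans ?_
    rw [show k * (π * r * u / 2) = (k * (π * r) / 2) * u by ring, abs_mul,
      abs_of_nonneg (by positivity)]
    gcongr
    have : (k : ℝ) ≤ 4 := by exact_mod_cast hk
    nlinarith
  have hH1 : ‖H - 1‖ ≤ π / (4 * r) * |u| ^ 3 := by
    refine (norm_exp_mul_I_sub_one_le _).trans ?_
    rw [abs_mul, abs_of_pos (by positivity), abs_div, abs_pow, abs_of_pos (by positivity : 0 < 1 + u ^ 2)]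
    gcongr
    exact div_le_self (by positivity) (by nlinarith [sq_nonneg u])
  have hS := norm_sqrtFactor_sub_one_le hr u
  have hB1 := norm_nome_sub_one_div_le hr hr1 u
  have hB2 := norm_nome_sub_one_div_sub_le hr hr1 u
  have hA := one_le_ampZero hr
  have hA' := ampZero_le hr hr1
  have hA0 : ‖(ampZero r : ℂ)‖ ≤ 1.008 := by
    rwa [norm_real, Real.norm_of_nonneg (by linarith)]
  rw [e]
  refine (norm_add₄_le).trans ?_
  simp only [norm_mul, hE, hH, mul_one]
  have i1 : ‖S - 1‖ * ‖B‖ ≤ |u| / 2 * 1.3636 := by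
    gcongr
    linarith
  have i2 : ‖(ampZero r : ℂ)‖ * ‖E - 1‖ ≤ 1.008 * (0.0316 * |u|) := by gcongr
  have i3 : ‖(ampZero r : ℂ)‖ * ‖H - 1‖ ≤ 1.008 * (π / (4 * r) * |u| ^ 3) := by gcongr
  have i4 : ‖B - ampZero r‖ ≤ 1.016 * |u| := hB2
  linarith

lemma re_amp_ge {r : ℝ} (hr : 0 < r) (hr1 : r ≤ 1 / 200) {k : ℕ} (hk : k ≤ 4) {u : ℝ}
    (hu : |u| ≤ 0.35) :
    1 - (1.73 * |u| + 1.008 * (π / (4 * r)) * |u| ^ 3) ^ 2 / 2 ≤ (amp r k u).re := by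
  have h1 := ampZero_le_norm_amp hr k u
  have h2 := norm_amp_sub_le hr hr1 hk hu
  have hA := one_le_ampZero hr
  set x := 1.73 * |u| + 1.008 * (π / (4 * r)) * |u| ^ 3
  have h3 : ‖amp r k u - ampZero r‖ ^ 2 = ‖amp r k u‖ ^ 2 - 2 * ampZero r * (amp r k u).re +
      ampZero r ^ 2 := by
    rw [← normSq_eq_norm_sq, ← normSq_eq_norm_sq, normSq_apply, normSq_apply]
    simp
    ring
  have h4 : ‖amp r k u - ampZero r‖ ^ 2 ≤ x ^ 2 := by gcongr
  have h5 : ampZero r ^ 2 ≤ ‖amp r k u‖ ^ 2 := by gcongr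
  have h6 : 2 * ampZero r * (1 - x ^ 2 / 2) ≤ 2 * ampZero r * (amp r k u).re := by
    nlinarith [sq_nonneg x, mul_nonneg (sub_nonneg.mpr hA) (sq_nonneg x)]
  exact le_of_mul_le_mul_left h6 (by linarith)

/-- The normalized modulus of `exp (i π r u) - 1`, with sign. -/
noncomputable def halfSine (r u : ℝ) : ℝ := 2 * Real.sin (π * r * u / 2) / (π * r)

lemma abs_halfSine_le {r : ℝ} (hr : 0 < r) (u : ℝ) : |halfSine r u| ≤ |u| := by
  have hb : 0 < π * r := by positivity
  rw [halfSine, abs_div, abs_mul, abs_of_pos hb, abs_two, div_le_iff₀ hb]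
  have := Real.abs_sin_le_abs (x := π * r * u / 2)
  rw [abs_div, abs_mul, abs_of_pos hb, abs_two] at this
  linarith

/-- The integrand representing the differences, along the line of real part `r`. -/
noncomputable def integrand (r : ℝ) (k n : ℕ) (u : ℝ) : ℂ :=
  (nome r (r * u) - 1) * (nome r (r * u) - Real.exp (π * r)) ^ k * nome r (r * u) ^ n *
    genLine r (r * u)

/-- The normalizing factor of `integrand`. -/
noncomputable def scale (r : ℝ) (k : ℕ) : ℝ :=
  √r / 2 * (π * r) * Real.exp (π / (4 * r)) ^ 2 * (π * r * Real.exp (π * r)) ^ k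

/-- The main part of the normalized integrand. -/
noncomputable def mainPart (r : ℝ) (k : ℕ) (u : ℝ) : ℂ :=
  (halfSine r u ^ k * Real.exp (-(π / (4 * r) * (u ^ 2 / (1 + u ^ 2)))) : ℝ) * amp r k u

lemma scale_pos {r : ℝ} (hr : 0 < r) (k : ℕ) : 0 < scale r k := by
  unfold scale
  positivity

lemma nome_sub_exp {r : ℝ} (hr : 0 < r) (u : ℝ) :
    nome r (r * u) - Real.exp (π * r) =
      (π * r * Real.exp (π * r) : ℝ) * (I * halfSine r u) * cexp ((π * r * u / 2 : ℝ) * I) := by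
  have hb : (π * r : ℂ) ≠ 0 := by exact_mod_cast (by positivity : 0 < π * r).ne'
  have h : cexp ((π * r * u : ℝ) * I) = cexp ((π * r * u / 2 : ℝ) * I) ^ 2 := by
    rw [← Complex.exp_nat_mul]
    push_cast
    ring_nf
  have h2 : cexp (-(π * r * u / 2 : ℝ) * I) * cexp ((π * r * u / 2 : ℝ) * I) = 1 := by
    rw [← Complex.exp_add, neg_mul, neg_add_cancel, Complex.exp_zero]
  have hs : (Real.sin (π * r * u / 2) : ℂ) = (cexp (-(π * r * u / 2 : ℝ) * I) -
      cexp ((π * r * u / 2 : ℝ) * I)) * I / 2 := by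
    rw [ofReal_sin, Complex.sin]
  have e0 : (halfSine r u : ℂ) = 2 * (Real.sin (π * r * u / 2) : ℂ) / (π * r) := by
    rw [halfSine]
    push_cast
    rfl
  rw [nome_mul, h, e0, hs]
  push_cast at h2 ⊢
  generalize cexp (-(π * r * u / 2) * I) = A at *
  generalize cexp (π * r * u / 2 * I) = B at *
  generalize cexp (π * r) = C at *
  have e : (π * r * C : ℂ) * (I * (2 * ((A - B) * I / 2) / (π * r))) * B =
      C * (A - B) * B * I ^ 2 * ((π * r) / (π * r)) := by ring
  rw [e, div_self hb, I_sq]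
  linear_combination C * h2

lemma genMain_line {r : ℝ} (hr : 0 < r) {n : ℕ} (hn : 4 * n * r ^ 2 = 1) (u : ℝ) :
    nome r (r * u) ^ n * genMain (r + (r * u : ℝ) * I) =
      (√r / 2 * Real.exp (π / (4 * r)) ^ 2 *
        Real.exp (-(π / (4 * r) * (u ^ 2 / (1 + u ^ 2)))) : ℝ) * sqrtFactor r u *
          cexp ((π / (4 * r) * (u ^ 3 / (1 + u ^ 2)) : ℝ) * I) := by
  have hs : (√r : ℂ) ≠ 0 := by exact_mod_cast (Real.sqrt_pos.mpr hr).ne'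
  have hr' : (r : ℂ) ≠ 0 := by exact_mod_cast hr.ne'
  have hu : (1 + u ^ 2 : ℂ) ≠ 0 := by exact_mod_cast (by positivity : 0 < 1 + u ^ 2).ne'
  have hn' : (n : ℂ) = 1 / (4 * r ^ 2) := by
    have : (4 * n * r ^ 2 : ℂ) = 1 := by exact_mod_cast hn
    field_simp
    linear_combination this
  have hu1 : (1 + u * I : ℂ) * (1 - u * I) = 1 + u ^ 2 := by
    linear_combination (-(u : ℂ) ^ 2) * I_sq
  have hu2 : (1 + u * I : ℂ) ≠ 0 := left_ne_zero_of_mul (hu1 ▸ hu)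
  have e : (π / (4 * (r + (r * u : ℝ) * I)) : ℂ) = π / (4 * r) * ((1 - u * I) / (1 + u ^ 2)) := by
    rw [← hu1]
    have hu3 : (1 - u * I : ℂ) ≠ 0 := right_ne_zero_of_mul (hu1 ▸ hu)
    push_cast
    rw [show (r + r * u * I : ℂ) = r * (1 + u * I) by ring]
    field_simp
  have e2 : nome r (r * u) ^ n * cexp (π / (4 * r) * ((1 - u * I) / (1 + u ^ 2))) =
      (Real.exp (π / (4 * r)) ^ 2 * Real.exp (-(π / (4 * r) * (u ^ 2 / (1 + u ^ 2)))) : ℝ) *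
        cexp ((π / (4 * r) * (u ^ 3 / (1 + u ^ 2)) : ℝ) * I) := by
    push_cast
    rw [nome, ← Complex.exp_nat_mul, ← Complex.exp_nat_mul, ← Complex.exp_add, ← Complex.exp_add,
      ← Complex.exp_add, hn']
    congr 1
    push_cast
    field_simp
    ring
  rw [genMain, e, sqrtFactor]
  rw [mul_left_comm, e2]
  push_cast
  field_simp

lemma main_eq {r : ℝ} (hr : 0 < r) {n : ℕ} (hn : 4 * n * r ^ 2 = 1) (k : ℕ) (u : ℝ) :
    (nome r (r * u) - 1) * (nome r (r * u) - Real.exp (π * r)) ^ k * nome r (r * u) ^ n *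
      genMain (r + (r * u : ℝ) * I) = scale r k * (I ^ k * mainPart r k u) := by
  have hb : (π * r : ℂ) ≠ 0 := by exact_mod_cast (by positivity : 0 < π * r).ne'
  have h1 : cexp ((k * (π * r * u / 2) : ℝ) * I) = cexp ((π * r * u / 2 : ℝ) * I) ^ k := by
    rw [← Complex.exp_nat_mul]
    push_cast
    ring_nf
  rw [mul_assoc, genMain_line hr hn, nome_sub_exp hr, mainPart, amp, scale, h1]
  have h2 : (nome r (r * u) - 1) = (π * r) * ((nome r (r * u) - 1) / (π * r : ℝ)) := by
    rw [ofReal_mul, mul_div_cancel₀ _ hb]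
  generalize ((nome r (r * u) - 1) / (π * r : ℝ)) = A at *
  rw [h2]
  push_cast
  ring

lemma norm_mainPart_le {r : ℝ} (hr : 0 < r) (k : ℕ) (u : ℝ) :
    ‖mainPart r k u‖ ≤ |u| ^ k * Real.exp (-(π / (4 * r) * (u ^ 2 / (1 + u ^ 2)))) *
      ‖amp r k u‖ := by
  rw [mainPart, norm_mul, norm_real, norm_mul, norm_pow, Real.norm_of_nonneg (Real.exp_pos _).le,
    Real.norm_eq_abs]
  have := pow_le_pow_left₀ (abs_nonneg _) (abs_halfSine_le hr u) k
  gcongr ?_ * _ * _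

lemma continuous_integrand {r : ℝ} (hr : 0 < r) (k n : ℕ) : Continuous (integrand r k n) := by
  have h1 := continuous_nome r
  have h2 := continuous_genLine hr
  unfold integrand
  fun_prop

lemma norm_integrand_sub_le {r : ℝ} (hr : 0 < r) (hr1 : r ≤ 1 / 200) {n : ℕ}
    (hn : 4 * n * r ^ 2 = 1) (k : ℕ) {u : ℝ} (hu : |u| ≤ 2) :
    ‖integrand r k n u / scale r k - I ^ k * mainPart r k u‖ ≤
      4 * Real.exp (-(1.6 * (π / (4 * r)))) * ‖mainPart r k u‖ := by
  have hK := scale_pos hr k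
  have hu' : u ^ 2 ≤ 4 := by nlinarith [sq_abs u, abs_nonneg u]
  have h1 : integrand r k n u / scale r k - I ^ k * mainPart r k u =
      (nome r (r * u) - 1) * (nome r (r * u) - Real.exp (π * r)) ^ k * nome r (r * u) ^ n *
      (genLine r (r * u) - genMain (r + (r * u : ℝ) * I)) / scale r k := by
    have hK' : (scale r k : ℂ) ≠ 0 := by exact_mod_cast hK.ne'
    rw [mul_sub, main_eq hr hn, integrand]
    field_simp
  have hre : ((r + (r * u : ℝ) * I : ℂ)⁻¹).re = 1 / (r * (1 + u ^ 2)) := by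
    rw [inv_re, normSq_apply]
    simp
    field_simp
  have hre2 : 1.6 * (π / (4 * r)) ≤ 2 * π * ((r + (r * u : ℝ) * I : ℂ)⁻¹).re := by
    rw [hre, show 1.6 * (π / (4 * r)) = 2 * π * (1 / (r * 5)) by ring]
    gcongr
    linarith
  have hle : Real.exp (-(2 * π * ((r + (r * u : ℝ) * I : ℂ)⁻¹).re)) ≤
      Real.exp (-(1.6 * (π / (4 * r)))) := Real.exp_le_exp.mpr (neg_le_neg hre2)
  have hbig : 2 ≤ 1.6 * (π / (4 * r)) := by
    rw [show 1.6 * (π / (4 * r)) = (0.4 * π) / r by ring, le_div_iff₀ hr]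
    nlinarith [Real.pi_gt_three]
  have hquart : Real.exp (-(1.6 * (π / (4 * r)))) ≤ 1 / 4 := by
    rw [Real.exp_neg, one_div]
    gcongr
    have := Real.exp_one_gt_d9
    calc (4 : ℝ) ≤ Real.exp 1 ^ 2 := by nlinarith
      _ = Real.exp 2 := by rw [← Real.exp_nat_mul]; norm_num
      _ ≤ _ := Real.exp_le_exp.mpr hbig
  have h2 := norm_gen_sub_genMain_le (t := r + (r * u : ℝ) * I) (by simpa) (hle.trans hquart)
  have h3 : ‖mainPart r k u‖ = ‖(nome r (r * u) - 1) * (nome r (r * u) - Real.exp (π * r)) ^ k *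
      nome r (r * u) ^ n‖ * ‖genMain (r + (r * u : ℝ) * I)‖ / scale r k := by
    rw [← norm_mul, main_eq hr hn, norm_mul, norm_mul, norm_pow, norm_I, one_pow, one_mul,
      norm_real, Real.norm_of_nonneg hK.le, mul_div_cancel_left₀ _ hK.ne']
  rw [h1, h3, norm_div, norm_mul, norm_real, Real.norm_of_nonneg hK.le, mul_div_assoc',
    mul_left_comm]
  gcongr
  refine h2.trans ?_
  gcongr

lemma norm_integrand_le_far {r : ℝ} (hr : 0 < r) (hr1 : r ≤ 1 / 200) {n : ℕ}
    (hn : 4 * n * r ^ 2 = 1) {k : ℕ} (hk : k ≤ 4) {u : ℝ} (hu : 2 ≤ |u|) (hu1 : |u| ≤ 1 / r) :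
    ‖integrand r k n u / scale r k‖ ≤
      1.008 * (2 / (π * r)) ^ 5 * Real.exp (-(109 / 100) / (π * r)) := by
  have hb : 0 < π * r := by positivity
  have hb1 : π * r ≤ 0.0158 := by nlinarith [Real.pi_lt_d2]
  have hE := Real.exp_pos (π * r)
  have hE1 := exp_pi_mul_le' hr hr1
  have hg := norm_gen_le (y := r * u) hr hr1 (by rw [abs_mul, abs_of_pos hr]; nlinarith)
    (by rw [abs_mul, abs_of_pos hr]; rw [le_div_iff₀ hr] at hu1; linarith)
  have h1 : ‖nome r (r * u) - 1‖ ≤ 2.016 := by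
    refine (norm_sub_le _ _).trans ?_
    rw [norm_nome, norm_one]
    linarith
  have h2 : ‖nome r (r * u) - Real.exp (π * r)‖ ≤ 2 * Real.exp (π * r) := by
    refine (norm_sub_le _ _).trans ?_
    rw [norm_nome, norm_real, Real.norm_of_nonneg hE.le]
    linarith
  have h3 : ‖nome r (r * u) ^ n‖ = Real.exp (π / (4 * r)) := by
    rw [norm_pow, norm_nome, ← Real.exp_nat_mul]
    congr 1
    field_simp
    linarith
  have hK := scale_pos hr k
  rw [norm_div, norm_real, Real.norm_of_nonneg hK.le, div_le_iff₀ hK, integrand, norm_mul, norm_mul,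
    norm_mul, norm_pow, h3, genLine]
  have h4 : (2 / (π * r)) ^ k ≤ (2 / (π * r)) ^ 4 :=
    pow_le_pow_right₀ (by rw [one_le_div hb]; linarith) hk
  calc _ ≤ 2.016 * (2 * Real.exp (π * r)) ^ k * Real.exp (π / (4 * r)) *
        (√r / 2 * Real.exp (π / (4 * r)) * Real.exp (-(109 / 100) / (π * r))) := by gcongr
    _ = 1.008 * (2 / (π * r)) * (2 / (π * r)) ^ k * Real.exp (-(109 / 100) / (π * r)) *
        scale r k := by
      rw [scale, mul_pow, mul_pow, div_pow]
      field_simp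
      ring
    _ ≤ 1.008 * (2 / (π * r)) * (2 / (π * r)) ^ 4 * Real.exp (-(109 / 100) / (π * r)) *
        scale r k := by gcongr
    _ = _ := by ring

lemma norm_amp_le {r : ℝ} (hr : 0 < r) (hr1 : r ≤ 1 / 200) (k : ℕ) {u b c : ℝ} (hu : |u| ≤ b)
    (hc : 0 ≤ c) (hb : 1 + b ^ 2 ≤ c ^ 4) : ‖amp r k u‖ ≤ c * (1.008 + 1.016 * b) := by
  rw [norm_amp]
  have h1 : ‖sqrtFactor r u‖ ≤ c := by
    refine le_of_pow_le_pow_left₀ (n := 4) (by norm_num) hc ?_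
    rw [norm_sqrtFactor_pow hr]
    nlinarith [sq_abs u, abs_nonneg u]
  have h2 := norm_nome_sub_one_div_le hr hr1 u
  gcongr
  linarith

lemma norm_integrand_le {r : ℝ} (hr : 0 < r) (hr1 : r ≤ 1 / 200) {n : ℕ}
    (hn : 4 * n * r ^ 2 = 1) (k : ℕ) {u b c s : ℝ} (hu : |u| ≤ b) (hb2 : b ≤ 2)
    (hc : 0 ≤ c) (hb : 1 + b ^ 2 ≤ c ^ 4) (hs : s * (1 + u ^ 2) ≤ u ^ 2) :
    ‖integrand r k n u / scale r k‖ ≤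
      (1 + 4 * Real.exp (-(1.6 * (π / (4 * r))))) *
        (b ^ k * (c * (1.008 + 1.016 * b)) * Real.exp (-(s * (π / (4 * r))))) := by
  have h1 := norm_integrand_sub_le hr hr1 hn k (hu.trans hb2)
  have h2 := norm_le_norm_add_norm_sub' (integrand r k n u / scale r k) (I ^ k * mainPart r k u)
  rw [norm_mul, norm_pow, norm_I, one_pow, one_mul] at h2
  have h3 := norm_mainPart_le hr k u
  have h4 := norm_amp_le hr hr1 k hu hc hb
  have h5 : ‖mainPart r k u‖ ≤
      b ^ k * (c * (1.008 + 1.016 * b)) * Real.exp (-(s * (π / (4 * r)))) := by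
    have hs' : s ≤ u ^ 2 / (1 + u ^ 2) := by rwa [le_div_iff₀ (by positivity)]
    have hb0 := (abs_nonneg u).trans hu
    calc _ ≤ _ := h3
      _ ≤ b ^ k * Real.exp (-(π / (4 * r) * s)) * (c * (1.008 + 1.016 * b)) := by gcongr
      _ = _ := by rw [mul_comm s]; ring
  calc _ ≤ (1 + 4 * Real.exp (-(1.6 * (π / (4 * r))))) * ‖mainPart r k u‖ := by linarith
    _ ≤ _ := by gcongr

lemma norm_integral_sub_integral_le {f : ℝ → ℂ} (hf : Continuous f) {c d C : ℝ} (hcd : c ≤ d)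
    (hc : 0 ≤ c) (h : ∀ u, c ≤ |u| → |u| ≤ d → ‖f u‖ ≤ C) :
    ‖(∫ u in -d..d, f u) - ∫ u in -c..c, f u‖ ≤ 2 * C * (d - c) := by
  have hi : ∀ x y, IntervalIntegrable f volume x y := fun x y ↦ hf.intervalIntegrable x y
  have e : (∫ u in -d..d, f u) - ∫ u in -c..c, f u =
      (∫ u in -d..-c, f u) + ∫ u in c..d, f u := by
    rw [← intervalIntegral.integral_add_adjacent_intervals (hi (-d) (-c)) (hi (-c) d),
      ← intervalIntegral.integral_add_adjacent_intervals (hi (-c) c) (hi c d)]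
    ring
  have h1 : ‖∫ u in -d..-c, f u‖ ≤ C * |-c - -d| := by
    refine intervalIntegral.norm_integral_le_of_norm_le_const fun u hu ↦ ?_
    rw [Set.uIoc_of_le (by linarith)] at hu
    have : |u| = -u := abs_of_nonpos (by linarith [hu.2])
    exact h u (by linarith [hu.2]) (by linarith [hu.1])
  have h2 : ‖∫ u in c..d, f u‖ ≤ C * |d - c| := by
    refine intervalIntegral.norm_integral_le_of_norm_le_const fun u hu ↦ ?_
    rw [Set.uIoc_of_le hcd] at hu
    have : |u| = u := abs_of_nonneg (by linarith [hu.1])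
    exact h u (by linarith [hu.1]) (by linarith [hu.2])
  rw [abs_of_nonneg (by linarith)] at h1 h2
  rw [e]
  refine (norm_add_le _ _).trans ?_
  linarith

lemma continuous_mainPart {r : ℝ} (hr : 0 < r) (k : ℕ) : Continuous (mainPart r k) := by
  have h1 := continuous_nome r
  have h2 : Continuous fun u : ℝ ↦ u ^ 2 / (1 + u ^ 2) :=
    (by fun_prop : Continuous fun u : ℝ ↦ u ^ 2).div (by fun_prop) fun u ↦ by positivity
  have h3 : Continuous fun u : ℝ ↦ u ^ 3 / (1 + u ^ 2) :=
    (by fun_prop : Continuous fun u : ℝ ↦ u ^ 3).div (by fun_prop) fun u ↦ by positivity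
  have h4 : Continuous (sqrtFactor r) := by
    unfold sqrtFactor
    refine Continuous.div_const (continuous_iff_continuousAt.mpr fun u ↦ ?_) _
    refine ContinuousAt.cpow (by fun_prop) continuousAt_const (Or.inl ?_)
    simpa
  unfold mainPart amp halfSine
  fun_prop

lemma far_bound {r : ℝ} (hr : 0 < r) (hr1 : r ≤ 1 / 200) :
    2 * (1.008 * (2 / (π * r)) ^ 5 * Real.exp (-(109 / 100) / (π * r))) * (1 / r - 2) ≤
      0.02 * Real.exp (-(0.109 * (π / (4 * r)))) := by
  have hb : 0 < π * r := by positivity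
  have hb1 : π * r ≤ 0.0158 := by nlinarith [Real.pi_lt_d2]
  set x := 1 / (π * r) with hx
  have hx1 : 63 ≤ x := by
    rw [hx, le_div_iff₀ hb]
    linarith
  have e1 : 1 / r = π * x := by
    rw [hx]
    field_simp
  have e2 : π / (4 * r) = π ^ 2 / 4 * x := by
    rw [hx]
    field_simp
  have e3 : 2 / (π * r) = 2 * x := by
    rw [hx]
    ring
  have e4 : -(109 / 100) / (π * r) = -1.09 * x := by
    rw [hx]
    ring
  rw [e1, e2, e3, e4]
  have h1 := Real.pow_div_factorial_le_exp (0.5 * x) (by positivity) 6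
  norm_num [Nat.factorial] at h1
  have h2 : Real.exp (-1.09 * x) =
      Real.exp (-(0.109 * (π ^ 2 / 4 * x))) *
        (Real.exp (-(0.59 - 0.109 * (π ^ 2 / 4)) * x) * Real.exp (-(1 / 2 * x))) := by
    rw [← Real.exp_add, ← Real.exp_add]
    congr 1
    ring
  have h3 : Real.exp (-(0.59 - 0.109 * (π ^ 2 / 4)) * x) ≤ 1 / 480000000 := by
    have : Real.exp (-(0.59 - 0.109 * (π ^ 2 / 4)) * x) ≤ Real.exp (-20) := by
      refine Real.exp_le_exp.mpr ?_
      have : π ^ 2 ≤ 9.93 := by nlinarith [Real.pi_lt_d2, Real.pi_gt_three]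
      nlinarith
    refine this.trans ?_
    rw [Real.exp_neg, one_div]
    gcongr
    calc (480000000 : ℝ) ≤ 2.7182818283 ^ 20 := by norm_num
      _ ≤ Real.exp 1 ^ 20 := by gcongr; exact Real.exp_one_gt_d9.le
      _ = _ := by rw [← Real.exp_nat_mul]; norm_num
  have h4 : x ^ 6 * Real.exp (-(1 / 2 * x)) ≤ 46080 := by
    rw [Real.exp_neg, ← div_eq_mul_inv, div_le_iff₀ (Real.exp_pos _)]
    nlinarith
  have hE := Real.exp_pos (-(0.109 * (π ^ 2 / 4 * x)))
  calc _ ≤ 2 * (1.008 * (2 * x) ^ 5 * Real.exp (-1.09 * x)) * (3.15 * x) := by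
        gcongr
        nlinarith [Real.pi_lt_d2]
    _ = 203.2128 * (Real.exp (-(0.59 - 0.109 * (π ^ 2 / 4)) * x) *
        (x ^ 6 * Real.exp (-(1 / 2 * x)))) * Real.exp (-(0.109 * (π ^ 2 / 4 * x))) := by
      rw [h2]
      ring
    _ ≤ 203.2128 * (1 / 480000000 * 46080) * Real.exp (-(0.109 * (π ^ 2 / 4 * x))) := by gcongr
    _ ≤ _ := by
      gcongr
      norm_num

lemma norm_shiftSub_sub_le {r : ℝ} (hr : 0 < r) (hr1 : r ≤ 1 / 200) {n : ℕ}
    (hn : 4 * n * r ^ 2 = 1) {k : ℕ} (hk : k ≤ 4) :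
    ‖((2 * ((shiftSub (Real.exp (π * r)))^[k] (fun m ↦ (dPbar m : ℝ)) n) / (r * scale r k) : ℝ) : ℂ)
      - I ^ k * ∫ u in (-0.35 : ℝ)..0.35, mainPart r k u‖ ≤
      4 * Real.exp (-(0.109 * (π / (4 * r)))) := by
  have hK := scale_pos hr k
  have hK' : (scale r k : ℂ) ≠ 0 := by exact_mod_cast hK.ne'
  set l := π / (4 * r) with hl
  have hl1 : 150 ≤ l := by
    rw [hl, le_div_iff₀ (by positivity)]
    linarith [Real.pi_gt_three]
  have hcont : Continuous fun u ↦ integrand r k n u / scale r k :=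
    (continuous_integrand hr k n).div_const _
  have hX : ((2 * ((shiftSub (Real.exp (π * r)))^[k] (fun m ↦ (dPbar m : ℝ)) n) /
      (r * scale r k) : ℝ) : ℂ) = ∫ u in -(1 / r)..(1 / r), integrand r k n u / scale r k := by
    have h1 := (represents_iterate hr (Real.exp (π * r)) k).2 n
    have h2 := intervalIntegral.integral_comp_mul_left (a := -(1 / r)) (b := 1 / r) (fun y ↦
      (nome r y - 1) * (nome r y - Real.exp (π * r)) ^ k * nome r y ^ n * genLine r y) hr.ne'
    rw [mul_neg, mul_one_div_cancel hr.ne', h1] at h2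
    rw [intervalIntegral.integral_div]
    unfold integrand
    rw [h2, real_smul]
    push_cast
    field_simp
  have hsmall : Real.exp (-(1.6 * l)) ≤ 0.0001 * Real.exp (-(0.109 * l)) := by
    rw [show -(1.6 * l) = -(1.491 * l) + -(0.109 * l) by ring, Real.exp_add]
    gcongr
    calc Real.exp (-(1.491 * l)) ≤ Real.exp (-20) := Real.exp_le_exp.mpr (by linarith)
      _ ≤ _ := by
        rw [Real.exp_neg, inv_le_comm₀ (Real.exp_pos _) (by norm_num)]
        calc (0.0001 : ℝ)⁻¹ ≤ 2.7182818283 ^ 20 := by norm_num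
          _ ≤ Real.exp 1 ^ 20 := by gcongr; exact Real.exp_one_gt_d9.le
          _ = _ := by rw [← Real.exp_nat_mul]; norm_num
  have hmid : Real.exp (-(0.5 * l)) ≤ 0.0001 * Real.exp (-(0.109 * l)) := by
    rw [show -(0.5 * l) = -(0.391 * l) + -(0.109 * l) by ring, Real.exp_add]
    gcongr
    calc Real.exp (-(0.391 * l)) ≤ Real.exp (-20) := Real.exp_le_exp.mpr (by linarith)
      _ ≤ _ := by
        rw [Real.exp_neg, inv_le_comm₀ (Real.exp_pos _) (by norm_num)]
        calc (0.0001 : ℝ)⁻¹ ≤ 2.7182818283 ^ 20 := by norm_num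
          _ ≤ Real.exp 1 ^ 20 := by gcongr; exact Real.exp_one_gt_d9.le
          _ = _ := by rw [← Real.exp_nat_mul]; norm_num
  have hE1 : Real.exp (-(0.109 * l)) ≤ 1 := Real.exp_le_one_iff.mpr (by linarith)
  have hE0 := Real.exp_pos (-(0.109 * l))
  have d1 := norm_integral_sub_integral_le hcont (c := 2) (d := 1 / r)
    (by rw [le_div_iff₀ hr]; linarith) (by norm_num)
    fun u hu hu1 ↦ norm_integrand_le_far hr hr1 hn hk hu hu1
  have d1' := d1.trans (far_bound hr hr1)
  have d2 := norm_integral_sub_integral_le hcont (c := 1) (d := 2) (C := 75 * Real.exp (-(0.5 * l)))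
    (by norm_num) (by norm_num) fun u hu hu1 ↦ by
      refine (norm_integrand_le hr hr1 hn k (b := 2) (c := 1.5) (s := 0.5) hu1 le_rfl (by norm_num)
        (by norm_num) (by nlinarith [sq_abs u])).trans ?_
      rw [← hl, ← mul_assoc]
      gcongr
      have : (2 : ℝ) ^ k ≤ 2 ^ 4 := pow_le_pow_right₀ (by norm_num) hk
      calc _ ≤ (1 + 4 * (0.0001 * 1 : ℝ)) * (2 ^ 4 * (1.5 * (1.008 + 1.016 * 2))) := by
            gcongr
            exact hsmall.trans (by gcongr)
        _ ≤ _ := by norm_num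
  have d3 := norm_integral_sub_integral_le hcont (c := 0.35) (d := 1)
    (C := 2.5 * Real.exp (-(0.109 * l)))
    (by norm_num) (by norm_num) fun u hu hu1 ↦ by
      refine (norm_integrand_le hr hr1 hn k (b := 1) (c := 1.19) (s := 0.109) hu1 (by norm_num)
        (by norm_num) (by norm_num) (by nlinarith [sq_abs u])).trans ?_
      rw [← hl, ← mul_assoc]
      gcongr
      calc _ ≤ (1 + 4 * (0.0001 * 1 : ℝ)) * (1 ^ k * (1.19 * (1.008 + 1.016 * 1))) := by
            gcongr
            exact hsmall.trans (by gcongr)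
        _ ≤ _ := by rw [one_pow]; norm_num
  have d4 : ‖(∫ u in (-0.35 : ℝ)..0.35, integrand r k n u / scale r k) -
      I ^ k * ∫ u in (-0.35 : ℝ)..0.35, mainPart r k u‖ ≤
      (10 * Real.exp (-(1.6 * l))) * |0.35 - (-0.35)| := by
    have hm : Continuous fun u ↦ I ^ k * mainPart r k u :=
      continuous_const.mul (continuous_mainPart hr k)
    rw [← intervalIntegral.integral_const_mul, ← intervalIntegral.integral_sub
      (hcont.intervalIntegrable _ _) (hm.intervalIntegrable _ _)]
    refine intervalIntegral.norm_integral_le_of_norm_le_const fun u hu ↦ ?_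
    rw [Set.uIoc_of_le (by norm_num)] at hu
    have hu' : |u| ≤ 1 := abs_le.mpr ⟨by linarith [hu.1], by linarith [hu.2]⟩
    refine (norm_integrand_sub_le hr hr1 hn k (by linarith)).trans ?_
    have h1 := norm_mainPart_le hr k u
    have h2 := norm_amp_le hr hr1 k (b := 1) (c := 1.19) hu' (by norm_num) (by norm_num)
    have h3 : |u| ^ k ≤ 1 := pow_le_one₀ (abs_nonneg u) hu'
    have h4 : Real.exp (-(π / (4 * r) * (u ^ 2 / (1 + u ^ 2)))) ≤ 1 :=
      Real.exp_le_one_iff.mpr (by rw [neg_nonpos]; positivity)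
    have h5 : ‖mainPart r k u‖ ≤ 1 * 1 * (1.19 * (1.008 + 1.016 * 1)) := by
      refine h1.trans ?_
      gcongr
    rw [← hl]
    nlinarith [Real.exp_pos (-(1.6 * l))]
  rw [abs_of_nonneg (by norm_num)] at d4
  rw [hX]
  calc _ ≤ _ := norm_sub_le_norm_sub_add_norm_sub _
        (∫ u in (-2 : ℝ)..2, integrand r k n u / scale r k) _
    _ ≤ _ := add_le_add_right (norm_sub_le_norm_sub_add_norm_sub _
        (∫ u in (-1 : ℝ)..1, integrand r k n u / scale r k) _) _
    _ ≤ _ := add_le_add_right (add_le_add_right (norm_sub_le_norm_sub_add_norm_sub _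
        (∫ u in (-0.35 : ℝ)..0.35, integrand r k n u / scale r k) _) _) _
    _ ≤ _ := by linarith

/-- The even moments of a Gaussian. -/
noncomputable def gaussMoment (b : ℝ) (j : ℕ) : ℝ := ∫ u : ℝ, u ^ (2 * j) * Real.exp (-(b * u ^ 2))

lemma integrable_pow_mul_gauss {b : ℝ} (hb : 0 < b) (j : ℕ) :
    Integrable fun u : ℝ ↦ u ^ (2 * j) * Real.exp (-(b * u ^ 2)) := by
  have h := integrable_rpow_mul_exp_neg_mul_sq hb (s := (2 * j : ℕ))
    (by linarith [Nat.cast_nonneg (α := ℝ) (2 * j)])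
  simpa only [Real.rpow_natCast, neg_mul] using h

lemma gaussMoment_eq {b : ℝ} (hb : 0 < b) (j : ℕ) :
    gaussMoment b j = (∏ i ∈ Finset.range j, (i + 1 / 2 : ℝ)) * √(π / b) / b ^ j := by
  have h1 : gaussMoment b j = b ^ (-((j : ℝ) + 1 / 2)) * Real.Gamma (j + 1 / 2) := by
    have e := integral_comp_abs (f := fun u : ℝ ↦ u ^ (2 * j) * Real.exp (-(b * u ^ 2)))
    have e2 := _root_.integral_rpow_mul_exp_neg_mul_rpow (p := 2) (q := (2 * j : ℕ)) (b := b) (by norm_num)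
      (by linarith [Nat.cast_nonneg (α := ℝ) (2 * j)]) hb
    simp only [Even.pow_abs (even_two_mul j), sq_abs] at e
    rw [gaussMoment, e]
    simp only [Real.rpow_natCast, Real.rpow_ofNat, neg_mul] at e2
    rw [e2, show -(((2 * j : ℕ) : ℝ) + 1) / 2 = -(j + 1 / 2) by push_cast; ring,
      show ((2 * j : ℕ) + 1 : ℝ) / 2 = j + 1 / 2 by push_cast; ring]
    ring
  have h2 : Real.Gamma (j + 1 / 2) = (∏ i ∈ Finset.range j, (i + 1 / 2 : ℝ)) * √π := by
    clear h1
    induction j with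
    | zero => simpa using Real.Gamma_one_half_eq
    | succ j ih =>
      rw [Finset.prod_range_succ, show ((j + 1 : ℕ) + 1 / 2 : ℝ) = (j + 1 / 2) + 1 by push_cast; ring,
        Real.Gamma_add_one (by positivity), ih]
      ring
  rw [h1, h2, Real.rpow_neg hb.le, Real.rpow_add hb, Real.rpow_natCast, ← Real.sqrt_eq_rpow,
    Real.sqrt_div Real.pi_nonneg]
  generalize ∏ i ∈ Finset.range j, (i + 1 / 2 : ℝ) = P
  field_simp

lemma integral_le_intervalIntegral {f h : ℝ → ℝ} {c : ℝ} (hc : 0 ≤ c) (hf : Continuous f)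
    (hh : Integrable h) (h1 : ∀ u, |u| ≤ c → h u ≤ f u) (h2 : ∀ u, c ≤ |u| → h u ≤ 0) :
    ∫ u, h u ≤ ∫ u in -c..c, f u := by
  rw [intervalIntegral.integral_of_le (by linarith), ← integral_indicator measurableSet_Ioc]
  refine integral_mono hh ?_ fun u ↦ ?_
  · rw [integrable_indicator_iff measurableSet_Ioc]
    exact hf.integrableOn_Ioc
  · by_cases hu : u ∈ Set.Ioc (-c) c
    · rw [Set.indicator_of_mem hu]
      exact h1 u (abs_le.mpr ⟨hu.1.le, hu.2⟩)
    · rw [Set.indicator_of_notMem hu]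
      refine h2 u ?_
      by_contra! hlt
      exact hu ⟨(abs_lt.mp hlt).1, (abs_lt.mp hlt).2.le⟩

lemma norm_intervalIntegral_le {f : ℝ → ℂ} {h : ℝ → ℝ} {c : ℝ} (hc : 0 ≤ c)
    (hh : Integrable h) (h1 : ∀ u, |u| ≤ c → ‖f u‖ ≤ h u) (h0 : ∀ u, 0 ≤ h u) :
    ‖∫ u in -c..c, f u‖ ≤ ∫ u, h u := by
  refine (intervalIntegral.norm_integral_le_of_norm_le (by linarith)
    (ae_of_all _ fun u hu ↦ h1 u (abs_le.mpr ⟨hu.1.le, hu.2⟩)) hh.intervalIntegrable).trans ?_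
  rw [intervalIntegral.integral_of_le (by linarith)]
  exact setIntegral_le_integral hh (ae_of_all _ h0)

lemma le_abs_halfSine {r : ℝ} (hr : 0 < r) (hr1 : r ≤ 1 / 200) {u : ℝ} (hu : |u| ≤ 0.35) :
    0.9999 * |u| ≤ |halfSine r u| := by
  have hb : 0 < π * r := by positivity
  have hb1 : π * r ≤ 0.0158 := by nlinarith [Real.pi_lt_d2]
  set x := π * r * u / 2 with hx
  have hx1 : |x| = π * r * |u| / 2 := by
    rw [hx, abs_div, abs_mul, abs_of_pos hb, abs_two]
  have hx2 : |x| ≤ 0.01 := by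
    rw [hx1]
    nlinarith [abs_nonneg u]
  have h1 := Real.sin_bound (x := x) (by linarith)
  have h2 : |x| ≤ |Real.sin x| + |Real.sin x - (x - x ^ 3 / 6)| + |x| ^ 3 / 6 := by
    have e : x = Real.sin x - (Real.sin x - (x - x ^ 3 / 6)) + x ^ 3 / 6 := by ring
    have a1 := abs_add_le (Real.sin x - (Real.sin x - (x - x ^ 3 / 6))) (x ^ 3 / 6)
    have a2 := abs_sub (Real.sin x) (Real.sin x - (x - x ^ 3 / 6))
    rw [← e, abs_div (x ^ 3), abs_pow, abs_of_pos (by norm_num : (0 : ℝ) < 6)] at a1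
    linarith
  have h3 : 0.9999 * |x| ≤ |Real.sin x| := by
    have h0 := abs_nonneg x
    have : |x| ^ 2 ≤ 0.0001 := by nlinarith
    have : |x| ^ 3 ≤ 0.0001 * |x| := by nlinarith
    have : |x| ^ 5 ≤ 0.0001 * |x| := by nlinarith [pow_nonneg h0 3]
    linarith
  rw [halfSine, abs_div, abs_mul, abs_of_pos hb, abs_two, le_div_iff₀ hb]
  rw [hx1] at h3
  linarith

lemma gauss_le_exp {l u : ℝ} (hl : 0 ≤ l) :
    Real.exp (-(l * u ^ 2)) ≤ Real.exp (-(l * (u ^ 2 / (1 + u ^ 2)))) := by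
  gcongr
  exact div_le_self (sq_nonneg u) (by nlinarith [sq_nonneg u])

lemma exp_le_gauss {l u : ℝ} (hl : 0 ≤ l) (hu : |u| ≤ 0.35) :
    Real.exp (-(l * (u ^ 2 / (1 + u ^ 2)))) ≤ Real.exp (-(l / 1.1225 * u ^ 2)) := by
  rw [show l / 1.1225 * u ^ 2 = l * (u ^ 2 / 1.1225) by ring]
  gcongr
  nlinarith [sq_abs u, abs_nonneg u]

lemma re_integral_mainPart_ge {r : ℝ} (hr : 0 < r) (hr1 : r ≤ 1 / 200) {j : ℕ} (hj : j ≤ 2) {l : ℝ}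
    (hl : l = π / (4 * r)) :
    0.999 * gaussMoment l j - gaussMoment l (j + 2) / 0.35 ^ 4 -
        (2.9929 * gaussMoment (l / 1.1225) (j + 1) +
          3.48768 * l * gaussMoment (l / 1.1225) (j + 2) +
          1.016064 * l ^ 2 * gaussMoment (l / 1.1225) (j + 3)) / 2 ≤
      (∫ u in (-0.35 : ℝ)..0.35, mainPart r (2 * j) u).re := by
  have hl0 : 0 < l := by
    rw [hl]
    positivity
  have hl1 : 0 < l / 1.1225 := by positivity
  have i (k : ℕ) := integrable_pow_mul_gauss hl0 k
  have i' (k : ℕ) := integrable_pow_mul_gauss hl1 k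
  have hm := continuous_mainPart hr (2 * j)
  have e := reCLM.intervalIntegral_comp_comm (hm.intervalIntegrable (μ := volume) (-0.35) 0.35)
  simp only [reCLM_apply] at e
  rw [← e]
  have hI1 := ((i j).const_mul 0.999).sub ((i (j + 2)).div_const (0.35 ^ 4))
  have hI2 := (((i' (j + 1)).const_mul 2.9929).add ((i' (j + 2)).const_mul (3.48768 * l))).add
    ((i' (j + 3)).const_mul (1.016064 * l ^ 2))
  refine le_trans (le_of_eq ?_) (integral_le_intervalIntegral (by norm_num)
    (continuous_re.comp hm) (hI1.sub (hI2.div_const 2)) (fun u hu ↦ ?_) fun u hu ↦ ?_)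
  · rw [integral_sub' hI1 (hI2.div_const 2), integral_sub' ((i j).const_mul 0.999)
      ((i (j + 2)).div_const (0.35 ^ 4)), integral_div, integral_div, integral_add'
      (((i' (j + 1)).const_mul 2.9929).add ((i' (j + 2)).const_mul (3.48768 * l)))
      ((i' (j + 3)).const_mul (1.016064 * l ^ 2)), integral_add'
      ((i' (j + 1)).const_mul 2.9929) ((i' (j + 2)).const_mul (3.48768 * l))]
    simp only [integral_const_mul, gaussMoment]
  · simp only [Pi.sub_apply, Pi.add_apply]
    have h1 := re_amp_ge hr hr1 (k := 2 * j) (by omega) hu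
    have h2 := gauss_le_exp (u := u) hl0.le
    have h3 := exp_le_gauss hl0.le hu
    have h4 : 0.999 * u ^ (2 * j) ≤ halfSine r u ^ (2 * j) := by
      have := pow_le_pow_left₀ (by positivity) (le_abs_halfSine hr hr1 hu) (2 * j)
      rw [Even.pow_abs (even_two_mul j), mul_pow, Even.pow_abs (even_two_mul j)] at this
      refine le_trans ?_ this
      have h0 : 0 ≤ u ^ (2 * j) := (even_two_mul j).pow_nonneg u
      gcongr
      calc (0.999 : ℝ) ≤ 0.9999 ^ 4 := by norm_num
        _ ≤ _ := pow_le_pow_of_le_one (by norm_num) (by norm_num) (by omega)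
    have h5 : halfSine r u ^ (2 * j) ≤ u ^ (2 * j) := by
      have := pow_le_pow_left₀ (by positivity) (abs_halfSine_le hr u) (2 * j)
      rwa [Even.pow_abs (even_two_mul j), Even.pow_abs (even_two_mul j)] at this
    have h0 : 0 ≤ u ^ (2 * j) := (even_two_mul j).pow_nonneg u
    have h6 : 0 ≤ halfSine r u ^ (2 * j) := (even_two_mul j).pow_nonneg _
    have h7 : (1.73 * |u| + 1.008 * (π / (4 * r)) * |u| ^ 3) ^ 2 =
        2.9929 * u ^ 2 + 3.48768 * l * u ^ 4 + 1.016064 * l ^ 2 * u ^ 6 := by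
      rw [← hl]
      have : |u| ^ 2 = u ^ 2 := sq_abs u
      linear_combination (2.9929 + 3.48768 * l * (|u| ^ 2 + u ^ 2) +
        1.016064 * l ^ 2 * (|u| ^ 4 + |u| ^ 2 * u ^ 2 + u ^ 4)) * this
    rw [mainPart, re_ofReal_mul, ← hl]
    rw [h7] at h1
    set P := halfSine r u ^ (2 * j)
    set W := Real.exp (-(l * (u ^ 2 / (1 + u ^ 2))))
    set G := Real.exp (-(l * u ^ 2))
    set G' := Real.exp (-(l / 1.1225 * u ^ 2))
    set Q := 2.9929 * u ^ 2 + 3.48768 * l * u ^ 4 + 1.016064 * l ^ 2 * u ^ 6 with hQ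
    have hQ0 : 0 ≤ Q := by positivity
    have hG : 0 < G := Real.exp_pos _
    have hW : 0 < W := Real.exp_pos _
    have a1 : P * W * (1 - Q / 2) ≤ P * W * (amp r (2 * j) u).re :=
      mul_le_mul_of_nonneg_left h1 (by positivity)
    have a2 : 0.999 * u ^ (2 * j) * G ≤ P * W := by gcongr
    have a3 : P * W * Q ≤ u ^ (2 * j) * G' * Q := by gcongr
    have a4 : 0 ≤ u ^ (2 * (j + 2)) * G / 0.35 ^ 4 :=
      div_nonneg (mul_nonneg ((even_two_mul (j + 2)).pow_nonneg u) hG.le) (by norm_num)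
    have a5 : 2.9929 * (u ^ (2 * (j + 1)) * G') + 3.48768 * l * (u ^ (2 * (j + 2)) * G') +
        1.016064 * l ^ 2 * (u ^ (2 * (j + 3)) * G') = u ^ (2 * j) * G' * Q := by
      rw [hQ]
      ring
    rw [a5]
    linarith
  · simp only [Pi.sub_apply, Pi.add_apply]
    have h0 : 0 ≤ u ^ (2 * j) := (even_two_mul j).pow_nonneg u
    have h8 (k : ℕ) : 0 ≤ u ^ (2 * k) := (even_two_mul k).pow_nonneg u
    have h1 : 0.35 ^ 4 ≤ u ^ 4 := by
      rw [← Even.pow_abs (by decide : Even 4) u]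
      gcongr
    have a1 : 0.999 * (u ^ (2 * j) * Real.exp (-(l * u ^ 2))) ≤
        u ^ (2 * (j + 2)) * Real.exp (-(l * u ^ 2)) / 0.35 ^ 4 := by
      rw [le_div_iff₀ (by norm_num), mul_add, pow_add]
      have h9 : 0 ≤ u ^ (2 * j) * Real.exp (-(l * u ^ 2)) := by positivity
      nlinarith
    have a2 : 0 ≤ (2.9929 * (u ^ (2 * (j + 1)) * Real.exp (-(l / 1.1225 * u ^ 2))) +
        3.48768 * l * (u ^ (2 * (j + 2)) * Real.exp (-(l / 1.1225 * u ^ 2))) +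
        1.016064 * l ^ 2 * (u ^ (2 * (j + 3)) * Real.exp (-(l / 1.1225 * u ^ 2)))) / 2 := by
      have := h8 (j + 1)
      have := h8 (j + 2)
      have := h8 (j + 3)
      positivity
    linarith

lemma norm_integral_mainPart_le {r : ℝ} (hr : 0 < r) (hr1 : r ≤ 1 / 200) {j : ℕ} (hj : j ≤ 1)
    {l : ℝ} (hl : l = π / (4 * r)) :
    ‖∫ u in (-0.35 : ℝ)..0.35, mainPart r (2 * j + 1) u‖ ≤
      1.73 * gaussMoment (l / 1.1225) (j + 1) + 1.008 * l * gaussMoment (l / 1.1225) (j + 2) := by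
  have hl0 : 0 < l := by
    rw [hl]
    positivity
  have hl1 : 0 < l / 1.1225 := by positivity
  have i' (k : ℕ) := integrable_pow_mul_gauss hl1 k
  have hm := continuous_mainPart hr (2 * j + 1)
  set w : ℝ → ℂ := fun u ↦
    (halfSine r u ^ (2 * j + 1) * Real.exp (-(π / (4 * r) * (u ^ 2 / (1 + u ^ 2)))) : ℝ) with hw
  have hwc : Continuous w := by
    have h2 : Continuous fun u : ℝ ↦ u ^ 2 / (1 + u ^ 2) :=
      (by fun_prop : Continuous fun u : ℝ ↦ u ^ 2).div (by fun_prop) fun u ↦ by positivity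
    unfold w halfSine
    fun_prop
  have hodd : ∫ u in (-0.35 : ℝ)..0.35, w u = 0 := by
    have h1 := intervalIntegral.integral_comp_neg (a := -0.35) (b := 0.35) w
    have h2 : ∀ u, w (-u) = -w u := fun u ↦ by
      have : halfSine r (-u) = -halfSine r u := by
        rw [halfSine, halfSine, mul_neg, neg_div, Real.sin_neg]
        ring
      rw [hw]
      simp only [this, neg_sq, Odd.neg_pow (odd_two_mul_add_one j)]
      push_cast
      ring
    simp only [h2, neg_neg, intervalIntegral.integral_neg] at h1
    exact self_eq_neg.mp h1.symm
  have e : ∫ u in (-0.35 : ℝ)..0.35, mainPart r (2 * j + 1) u =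
      ∫ u in (-0.35 : ℝ)..0.35, w u * (amp r (2 * j + 1) u - ampZero r) := by
    have : ∀ u, w u * (amp r (2 * j + 1) u - ampZero r) =
        mainPart r (2 * j + 1) u - w u * ampZero r := fun u ↦ by
      rw [mainPart, hw]
      ring
    simp only [this]
    have hwA : Continuous fun u ↦ w u * (ampZero r : ℂ) := hwc.mul continuous_const
    rw [intervalIntegral.integral_sub (hm.intervalIntegrable _ _)
      (hwA.intervalIntegrable _ _), intervalIntegral.integral_mul_const,
      hodd, zero_mul, sub_zero]
  have hI := ((i' (j + 1)).const_mul 1.73).add ((i' (j + 2)).const_mul (1.008 * l))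
  rw [e]
  refine (norm_intervalIntegral_le (by norm_num) hI (fun u hu ↦ ?_) fun u ↦ ?_).trans (le_of_eq ?_)
  · simp only [Pi.add_apply]
    have h1 := norm_amp_sub_le hr hr1 (k := 2 * j + 1) (by omega) hu
    have h3 := exp_le_gauss hl0.le hu
    have h5 := pow_le_pow_left₀ (by positivity) (abs_halfSine_le hr u) (2 * j + 1)
    rw [norm_mul, hw, norm_real, norm_mul, norm_pow, Real.norm_of_nonneg (Real.exp_pos _).le,
      Real.norm_eq_abs, ← hl]
    rw [← hl] at h1
    have h6 (k : ℕ) : u ^ (2 * k) = |u| ^ (2 * k) := (Even.pow_abs (even_two_mul k) u).symm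
    calc _ ≤ |u| ^ (2 * j + 1) * Real.exp (-(l / 1.1225 * u ^ 2)) *
          (1.73 * |u| + 1.008 * l * |u| ^ 3) := by gcongr
      _ = _ := by
        rw [h6, h6]
        ring
  · have h8 (k : ℕ) : 0 ≤ u ^ (2 * k) := (even_two_mul k).pow_nonneg u
    have := h8 (j + 1)
    have := h8 (j + 2)
    simp only [Pi.add_apply]
    positivity
  · simp only [Pi.add_apply]
    rw [integral_add ((i' (j + 1)).const_mul 1.73) ((i' (j + 2)).const_mul (1.008 * l))]
    simp only [integral_const_mul, gaussMoment]

lemma gaussMoment_div_eq {l : ℝ} (hl : 0 < l) (j : ℕ) :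
    gaussMoment (l / 1.1225) j =
      √1.1225 * 1.1225 ^ j * ((∏ i ∈ Finset.range j, (i + 1 / 2 : ℝ)) * √(π / l) / l ^ j) := by
  rw [gaussMoment_eq (by positivity), show π / (l / 1.1225) = 1.1225 * (π / l) by field_simp,
    Real.sqrt_mul (by norm_num), div_pow]
  generalize ∏ i ∈ Finset.range j, (i + 1 / 2 : ℝ) = P
  field_simp

lemma four_mul_exp_le {l : ℝ} (hl : 157 ≤ l) :
    4 * Real.exp (-(0.109 * l)) ≤ 0.03 * (√(π / l) / l ^ 2) := by
  have hl0 : 0 < l := by linarith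
  have h1 : 22 / l ≤ √(π / l) := by
    refine Real.le_sqrt_of_sq_le ?_
    rw [div_pow, div_le_div_iff₀ (by positivity) hl0]
    nlinarith [Real.pi_gt_d2]
  have h2 : l ^ 3 ≤ 157 ^ 3 * Real.exp (0.109 * (l - 157)) := by
    have h3 : l / 157 ≤ Real.exp (0.109 * (l - 157) / 3) := by
      linarith [Real.add_one_le_exp (0.109 * (l - 157) / 3)]
    calc l ^ 3 = 157 ^ 3 * (l / 157) ^ 3 := by ring
      _ ≤ 157 ^ 3 * Real.exp (0.109 * (l - 157) / 3) ^ 3 := by gcongr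
      _ = _ := by
        rw [← Real.exp_nat_mul]
        norm_num
        ring_nf
  have h4 : 157 ^ 3 / 0.165 ≤ Real.exp 17.113 := by
    rw [show (17.113 : ℝ) = (17 : ℕ) * 1 + 0.113 by norm_num, Real.exp_add, Real.exp_nat_mul]
    calc (157 ^ 3 / 0.165 : ℝ) ≤ 2.7182818283 ^ 17 * (0.113 + 1) := by norm_num
      _ ≤ _ := by
        gcongr
        · exact Real.exp_one_gt_d9.le
        · exact Real.add_one_le_exp _
  have h5 : l ^ 3 ≤ 0.165 * Real.exp (0.109 * l) := by
    rw [show 0.109 * l = 17.113 + 0.109 * (l - 157) by ring, Real.exp_add]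
    nlinarith [Real.exp_pos (0.109 * (l - 157))]
  calc 4 * Real.exp (-(0.109 * l)) ≤ 0.03 * (22 / l / l ^ 2) := by
        rw [Real.exp_neg, ← div_eq_mul_inv, div_div, ← pow_succ', mul_div_assoc',
          div_le_div_iff₀ (Real.exp_pos _) (by positivity)]
        linarith
    _ ≤ _ := by gcongr

lemma abs_le_of_norm_sub_le {x e b : ℝ} {k : ℕ} {z : ℂ} (h : ‖(x : ℂ) - I ^ k * z‖ ≤ e)
    (hz : ‖z‖ ≤ b) : |x| ≤ b + e := by
  have h1 := norm_le_norm_add_norm_sub' (x : ℂ) (I ^ k * z)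
  rw [norm_mul, norm_pow, norm_I, one_pow, one_mul, norm_real, Real.norm_eq_abs] at h1
  linarith

lemma le_of_norm_sub_le {x e b : ℝ} {z : ℂ} (h : ‖(x : ℂ) - z‖ ≤ e) (hz : b ≤ z.re) :
    b - e ≤ x := by
  have h1 := (abs_re_le_norm _).trans h
  rw [sub_re, ofReal_re, abs_le] at h1
  linarith

/-- The Laguerre inequality in the range of the saddle point method. -/
lemma laguerre_of_large {n : ℕ} (hn : 10000 ≤ n) :
    3 * (dPbar (n + 2)) ^ 2 - 4 * dPbar (n + 1) * dPbar (n + 3) + dPbar n * dPbar (n + 4) > 0 := by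
  have hn' : (10000 : ℝ) ≤ n := by exact_mod_cast hn
  have hs : 100 ≤ √(n : ℝ) := Real.le_sqrt_of_sq_le (by norm_num; linarith)
  have hsq : √(n : ℝ) ^ 2 = n := Real.sq_sqrt (by positivity)
  set r := 1 / (2 * √(n : ℝ)) with hrdef
  have hr : 0 < r := by positivity
  have hr1 : r ≤ 1 / 200 := by
    rw [hrdef]
    gcongr
    linarith
  have hnr : 4 * (n : ℝ) * r ^ 2 = 1 := by
    rw [hrdef, div_pow, mul_pow, hsq]
    field_simp
    norm_num
  obtain ⟨l, hl⟩ : ∃ l, l = π / (4 * r) := ⟨_, rfl⟩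
  have hl1 : 157 ≤ l := by
    rw [hl, le_div_iff₀ (by positivity)]
    nlinarith [Real.pi_gt_d2]
  have hl0 : 0 < l := by linarith
  set m := √(π / l) with hm
  have hm0 : 0 < m := by positivity
  set a := Real.exp (π * r) with ha
  set F : ℕ → ℝ := fun m ↦ (dPbar m : ℝ) with hF
  set e := 4 * Real.exp (-(0.109 * l)) with he
  have he1 : e ≤ 0.03 * (m / l ^ 2) := four_mul_exp_le hl1
  set X : ℕ → ℝ := fun k ↦ 2 * ((shiftSub a)^[k] F n) / (r * scale r k) with hX
  have hq : √1.1225 ≤ 1.0595 := Real.sqrt_le_iff.mpr ⟨by norm_num, by norm_num⟩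
  have hq0 : 0 ≤ √1.1225 := Real.sqrt_nonneg _
  have key {k : ℕ} (hk : k ≤ 4) := norm_shiftSub_sub_le hr hr1 hnr hk
  simp only [← hl, ← he, ← hF, ← ha] at key
  have hml : 0 < m / l := by positivity
  have hml2 : 0 < m / l ^ 2 := by positivity
  have i1 : m / l ≤ m / 157 := by gcongr
  have i2 : m / l ^ 2 ≤ m / l / 157 := by
    rw [pow_two, ← div_div]
    gcongr
  have i3 : m / l ^ 3 ≤ m / l ^ 2 / 157 := by
    rw [pow_succ, ← div_div]
    gcongr
  have i4 : m / l ^ 4 ≤ m / l ^ 2 / 157 ^ 2 := by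
    rw [show l ^ 4 = l ^ 2 * l ^ 2 by ring, ← div_div]
    gcongr
  have g (j : ℕ) := gaussMoment_eq hl0 j
  have g' (j : ℕ) := gaussMoment_div_eq hl0 j
  simp only [← hm] at g g'
  generalize √1.1225 = q at *
  have x0 : 0.96 * m ≤ X 0 := by
    have h := re_integral_mainPart_ge hr hr1 (j := 0) (by norm_num) hl
    have k0 := key (k := 0) (by norm_num)
    rw [pow_zero, one_mul] at k0
    refine le_trans ?_ (le_of_norm_sub_le k0 h)
    have h1 : 2.9929 * gaussMoment (l / 1.1225) (0 + 1) +
        3.48768 * l * gaussMoment (l / 1.1225) (0 + 2) +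
        1.016064 * l ^ 2 * gaussMoment (l / 1.1225) (0 + 3) ≤ q * 7.6703 * (m / l) := by
      refine le_of_eq_of_le (b := q * (2.9929 * 1.1225 / 2 + 3.48768 * 1.1225 ^ 2 * 3 / 4 +
        1.016064 * 1.1225 ^ 3 * 15 / 8) * (m / l)) ?_ (by gcongr; norm_num)
      simp only [g', Finset.prod_range_succ, Finset.prod_range_zero]
      push_cast
      field_simp
      ring
    have h2 : gaussMoment l 0 = m := by simp [g]
    have h3 : gaussMoment l (0 + 2) = 3 / 4 * (m / l ^ 2) := by
      simp only [g, Finset.prod_range_succ, Finset.prod_range_zero]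
      push_cast
      ring
    rw [h2, h3]
    have h4 : q * 7.6703 * (m / l) ≤ 1.0595 * 7.6703 * (m / l) := by gcongr
    have h5 := h1.trans h4
    clear h h1 k0
    generalize 2.9929 * _ + _ + _ = Q at h5 ⊢
    norm_num at h5 ⊢
    linarith
  have x4 : 0.36 * (m / l ^ 2) ≤ X 4 := by
    have h := re_integral_mainPart_ge hr hr1 (j := 2) (by norm_num) hl
    have k0 := key (k := 4) (by norm_num)
    rw [I_pow_four, one_mul] at k0
    refine le_trans ?_ (le_of_norm_sub_le k0 h)
    have h1 : 2.9929 * gaussMoment (l / 1.1225) (2 + 1) +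
        3.48768 * l * gaussMoment (l / 1.1225) (2 + 2) +
        1.016064 * l ^ 2 * gaussMoment (l / 1.1225) (2 + 3) ≤ q * 97.75 * (m / l ^ 3) := by
      refine le_of_eq_of_le (b := q * (2.9929 * 1.1225 ^ 3 * 15 / 8 +
        3.48768 * 1.1225 ^ 4 * 105 / 16 + 1.016064 * 1.1225 ^ 5 * 945 / 32) * (m / l ^ 3)) ?_
        (by gcongr; norm_num)
      simp only [g', Finset.prod_range_succ, Finset.prod_range_zero]
      push_cast
      field_simp
      ring
    have h2 : gaussMoment l 2 = 3 / 4 * (m / l ^ 2) := by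
      simp only [g, Finset.prod_range_succ, Finset.prod_range_zero]
      push_cast
      ring
    have h3 : gaussMoment l (2 + 2) = 105 / 16 * (m / l ^ 4) := by
      simp only [g, Finset.prod_range_succ, Finset.prod_range_zero]
      push_cast
      ring
    rw [h2, h3]
    have h4 : q * 97.75 * (m / l ^ 3) ≤ 1.0595 * 97.75 * (m / l ^ 3) := by gcongr
    have h5 := h1.trans h4
    clear h h1 k0
    generalize 2.9929 * _ + _ + _ = Q at h5 ⊢
    norm_num at h5 ⊢
    linarith
  have x1 : |X 1| ≤ 2.04 * (m / l) := by
    have h := norm_integral_mainPart_le hr hr1 (j := 0) (by norm_num) hl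
    refine (abs_le_of_norm_sub_le (key (k := 1) (by norm_num)) h).trans ?_
    have h1 : 1.73 * gaussMoment (l / 1.1225) (0 + 1) +
        1.008 * l * gaussMoment (l / 1.1225) (0 + 2) ≤ q * 1.9237 * (m / l) := by
      refine le_of_eq_of_le (b := q * (1.73 * 1.1225 / 2 + 1.008 * 1.1225 ^ 2 * 3 / 4) * (m / l)) ?_
        (by gcongr; norm_num)
      simp only [g', Finset.prod_range_succ, Finset.prod_range_zero]
      push_cast
      field_simp
      ring
    have h4 : q * 1.9237 * (m / l) ≤ 1.0595 * 1.9237 * (m / l) := by gcongr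
    linarith
  have x3 : |X 3| ≤ 4.6 * (m / l ^ 2) := by
    have h := norm_integral_mainPart_le hr hr1 (j := 1) (by norm_num) hl
    refine (abs_le_of_norm_sub_le (key (k := 3) (by norm_num)) h).trans ?_
    have h1 : 1.73 * gaussMoment (l / 1.1225) (1 + 1) +
        1.008 * l * gaussMoment (l / 1.1225) (1 + 2) ≤ q * 4.3082 * (m / l ^ 2) := by
      refine le_of_eq_of_le (b := q * (1.73 * 1.1225 ^ 2 * 3 / 4 + 1.008 * 1.1225 ^ 3 * 15 / 8) *
        (m / l ^ 2)) ?_ (by gcongr; norm_num)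
      simp only [g', Finset.prod_range_succ, Finset.prod_range_zero]
      push_cast
      field_simp
      ring
    have h4 : q * 4.3082 * (m / l ^ 2) ≤ 1.0595 * 4.3082 * (m / l ^ 2) := by gcongr
    linarith
  have hprod : 4 * (X 1 * X 3) < X 0 * X 4 := by
    have h1 : X 1 * X 3 ≤ 2.04 * (m / l) * (4.6 * (m / l ^ 2)) := by
      refine (le_abs_self _).trans ?_
      rw [abs_mul]
      gcongr
    have h2 : 2.04 * (m / l) * (4.6 * (m / l ^ 2)) ≤ 2.04 * (m / 157) * (4.6 * (m / l ^ 2)) := by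
      gcongr
    have h3 : 0.96 * m * (0.36 * (m / l ^ 2)) ≤ X 0 * X 4 := by
      have := hml2.le
      gcongr
      linarith
    have h4 : 0 < m * (m / l ^ 2) := by positivity
    linarith
  have hXF (k : ℕ) : (shiftSub a)^[k] F n = r / 2 * scale r k * X k := by
    have := (scale_pos hr k).ne'
    rw [hX]
    field_simp
  have hscale : scale r 1 * scale r 3 = scale r 0 * scale r 4 := by
    simp only [scale]
    ring
  have hfin := laguerre_eq_shiftSub a F n
  simp only [hXF] at hfin
  have hpos : 0 < (r / 2) ^ 2 * (scale r 0 * scale r 4) * (X 0 * X 4 - 4 * (X 1 * X 3)) := by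
    have := scale_pos hr 0
    have := scale_pos hr 4
    have := sub_pos.mpr hprod
    positivity
  have hreal : 0 < 3 * F (n + 2) ^ 2 - 4 * F (n + 1) * F (n + 3) + F n * F (n + 4) := by
    rw [hfin]
    have e3 : 4 * (r / 2 * scale r 1 * X 1) * (r / 2 * scale r 3 * X 3) =
        (r / 2) ^ 2 * (scale r 0 * scale r 4) * (4 * (X 1 * X 3)) := by
      rw [← hscale]
      ring
    rw [e3]
    nlinarith [sq_nonneg (r / 2 * scale r 2 * X 2)]
  simp only [hF] at hreal
  exact_mod_cast hreal

end Overpartition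

namespace Overpartition

open Finset Filter Topology
open scoped Real

/-- The coefficients of the theta series `∑ (-1) ^ k q ^ (k ^ 2)`. -/
def thetaCoeff (m : ℕ) : ℤ := if m = 0 then 1 else if IsSquare m then 2 * (-1) ^ m else 0

lemma thetaCoeff_succ_sq (k : ℕ) : thetaCoeff ((k + 1) ^ 2) = 2 * (-1) ^ (k + 1) := by
  rw [thetaCoeff, if_neg (by positivity), if_pos ⟨k + 1, pow_two _⟩, pow_two, pow_mul]
  rcases neg_one_pow_eq_or ℤ (k + 1) with h | h
  · rw [h, one_pow]
  · rw [h, Odd.neg_one_pow]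
    rw [← Nat.not_even_iff_odd]
    intro he
    rw [he.neg_one_pow] at h
    norm_num at h

lemma hasSum_thetaCoeff {q : ℂ} (hq : ‖q‖ < 1) :
    HasSum (fun m ↦ (thetaCoeff m : ℂ) * q ^ m) (theta q) := by
  have hs : Summable fun k : ℤ ↦ (-1 : ℂ) ^ k * q ^ (k ^ 2) := by
    refine Summable.of_norm ((summable_zpow_sq (norm_nonneg q) hq).congr fun k ↦ ?_)
    simp
  have h1 := hs.hasSum.nat_add_neg.sub (hasSum_ite_eq (0 : ℕ) (1 : ℂ))
  have hinj : Function.Injective fun k : ℕ ↦ k ^ 2 := Nat.pow_left_injective two_ne_zero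
  rw [← hinj.hasSum_iff]
  · convert! h1 using 1
    · ext k
      rcases k with _ | k
      · simp [thetaCoeff]
      · have e1 : ((k + 1 : ℕ) : ℤ) ^ 2 = ((k + 1) ^ 2 : ℕ) := by push_cast; ring
        rw [Function.comp_apply, thetaCoeff_succ_sq, neg_sq, if_neg k.succ_ne_zero, e1, zpow_natCast,
          zpow_neg, zpow_natCast, zpow_natCast, ← inv_pow, inv_neg_one]
        push_cast
        ring
    · simp [theta]
  · intro m hm
    rw [thetaCoeff, if_neg, if_neg, Int.cast_zero, zero_mul]
    · rintro ⟨k, rfl⟩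
      exact hm ⟨k, pow_two k⟩
    · rintro rfl
      exact hm ⟨0, rfl⟩

lemma norm_thetaCoeff_le (m : ℕ) : ‖(thetaCoeff m : ℂ)‖ ≤ 2 := by
  rw [thetaCoeff]
  split_ifs <;> simp

lemma hasSum_sum_antidiagonal_thetaCoeff {q : ℂ} (hq : ‖q‖ < 1) (h0 : q ≠ 0) :
    HasSum (fun n ↦ q ^ n * ∑ p ∈ antidiagonal n, (overpartitionFn p.1 : ℂ) * thetaCoeff p.2) 1 := by
  have hf := summable_norm_overpartitionFn hq
  have hg : Summable fun m ↦ ‖(thetaCoeff m : ℂ) * q ^ m‖ := by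
    refine Summable.of_nonneg_of_le (fun _ ↦ norm_nonneg _) (fun m ↦ ?_)
      ((summable_geometric_of_lt_one (norm_nonneg q) hq).mul_left 2)
    rw [norm_mul, norm_pow]
    gcongr
    exact norm_thetaCoeff_le m
  have h1 := (summable_norm_sum_mul_antidiagonal_of_summable_norm hf hg).of_norm.hasSum
  rw [← tsum_mul_tsum_eq_tsum_sum_antidiagonal_of_summable_norm hf hg, (hasSum_thetaCoeff hq).tsum_eq,
    tsum_overpartitionFn_mul_theta hq h0] at h1
  convert! h1 using 2 with n
  rw [mul_sum]
  refine sum_congr rfl fun p hp ↦ ?_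
  rw [← HasAntidiagonal.mem_antidiagonal.mp hp, pow_add]
  ring

lemma sum_antidiagonal_thetaCoeff (n : ℕ) :
    ∑ p ∈ antidiagonal n, (overpartitionFn p.1 : ℤ) * thetaCoeff p.2 = if n = 0 then 1 else 0 := by
  have hone : overpartitionFn 0 = 1 := by simp [overpartitionFn]
  set c : ℕ → ℂ := fun n ↦
    ∑ p ∈ antidiagonal n, (overpartitionFn p.1 : ℂ) * thetaCoeff p.2 - if n = 0 then 1 else 0
  have hp : HasFPowerSeriesAt (0 : ℂ → ℂ) (FormalMultilinearSeries.ofScalars ℂ c) 0 := by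
    rw [hasFPowerSeriesAt_iff]
    filter_upwards [Metric.ball_mem_nhds (0 : ℂ) one_pos] with q hq
    rw [mem_ball_zero_iff] at hq
    simp only [FormalMultilinearSeries.coeff_ofScalars, smul_eq_mul, Pi.zero_apply, c]
    rcases eq_or_ne q 0 with rfl | h0
    · convert! (hasSum_zero : HasSum (fun _ : ℕ ↦ (0 : ℂ)) 0) using 2 with n
      rcases n with _ | n <;> simp [hone, thetaCoeff]
    · have := (hasSum_sum_antidiagonal_thetaCoeff hq h0).sub (hasSum_ite_eq (0 : ℕ) (1 : ℂ))
      rw [sub_self] at this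
      convert! this using 2 with n
      rw [mul_sub]
      rcases n with _ | n <;> simp
  have h := congrArg (fun p ↦ p.coeff n) hp.eq_zero
  simp only [FormalMultilinearSeries.coeff_ofScalars, c] at h
  rw [show (0 : FormalMultilinearSeries ℂ ℂ ℂ).coeff n = 0 from rfl, sub_eq_zero] at h
  exact_mod_cast h

lemma sum_thetaCoeff (B : ℤ) (K : ℕ) : ∑ j ∈ range ((K + 1) ^ 2), thetaCoeff j * B ^ j =
    1 + ∑ k ∈ range K, 2 * (-1) ^ (k + 1) * B ^ ((k + 1) ^ 2) := by
  induction K with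
  | zero => simp [thetaCoeff]
  | succ K ih =>
    rw [sum_range_succ, ← add_assoc, ← ih, show (K + 1 + 1) ^ 2 = (K + 1) ^ 2 + (2 * K + 2 + 1) by ring,
      sum_range_add, sum_range_succ', add_zero, thetaCoeff_succ_sq, add_right_inj, add_eq_right]
    refine sum_eq_zero fun i hi ↦ ?_
    rw [mem_range] at hi
    rw [thetaCoeff, if_neg (by positivity), if_neg, zero_mul]
    rintro ⟨s, hs⟩
    have h1 : K + 1 < s := by
      by_contra! h
      nlinarith
    have h2 : s < K + 2 := by
      by_contra! h
      nlinarith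
    omega

lemma dvd_sum_mul_sum_sub_one {f g : ℕ → ℤ}
    (h : ∀ n, ∑ p ∈ antidiagonal n, f p.1 * g p.2 = if n = 0 then 1 else 0) (B : ℤ) {N M : ℕ}
    (hNM : N ≤ M) :
    B ^ N ∣ (∑ n ∈ range N, f n * B ^ n) * (∑ n ∈ range M, g n * B ^ n) - 1 := by
  set P : Polynomial ℤ := ∑ n ∈ range N, Polynomial.C (f n) * Polynomial.X ^ n
  set Q : Polynomial ℤ := ∑ n ∈ range M, Polynomial.C (g n) * Polynomial.X ^ n
  have hP (n : ℕ) : P.coeff n = if n < N then f n else 0 := by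
    simp [P, Polynomial.coeff_X_pow]
  have hQ (n : ℕ) : Q.coeff n = if n < M then g n else 0 := by
    simp [Q, Polynomial.coeff_X_pow]
  have hd : Polynomial.X ^ N ∣ P * Q - 1 := by
    rw [Polynomial.X_pow_dvd_iff]
    intro d hd
    rw [Polynomial.coeff_sub, Polynomial.coeff_mul, Polynomial.coeff_one, ← h d, sub_eq_zero]
    refine sum_congr rfl fun p hp ↦ ?_
    rw [HasAntidiagonal.mem_antidiagonal] at hp
    rw [hP, hQ, if_pos (by omega), if_pos (by omega)]
  have := map_dvd (Polynomial.evalRingHom B) hd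
  simpa [P, Q, Polynomial.eval_finsetSum] using this

/-- Applies `f` to `n`, making the kernel evaluate `n` first. -/
def force {α : Type} (n : ℕ) (f : ℕ → α) : α :=
  Nat.rec (f 0) (fun k _ ↦ f (k + 1)) n

lemma force_eq {α : Type} (n : ℕ) (f : ℕ → α) : force n f = f n := by
  cases n <;> rfl

/-- The Laguerre inequality for the differences of the six lowest base `B` digits of `x`. -/
def digitsCheck (B x : ℕ) : Bool :=
  let p (i : ℕ) : ℤ := (x / B ^ i % B : ℕ)
  decide (3 * (p 3 - p 2) ^ 2 - 4 * (p 2 - p 1) * (p 4 - p 3) + (p 1 - p 0) * (p 5 - p 4) > 0)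

/-- Checks all windows of six consecutive digits beginning at one of the lowest `2 ^ d` digits. -/
def windowsCheck (B : ℕ) : ℕ → ℕ → Bool
  | 0, x => digitsCheck B x
  | d + 1, x => force (x % B ^ (2 ^ d + 5)) (windowsCheck B d) &&
      force (x / B ^ (2 ^ d)) (windowsCheck B d)

/-- The even part of a truncated theta series. -/
def thetaEven (B : ℕ) : ℕ → ℕ
  | 0 => 1
  | m + 1 => thetaEven B m + 2 * B ^ ((2 * m + 2) ^ 2)

/-- The odd part of a truncated theta series, with the opposite sign. -/
def thetaOdd (B : ℕ) : ℕ → ℕ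
  | 0 => 0
  | m + 1 => thetaOdd B m + 2 * B ^ ((2 * m + 1) ^ 2)

/-- Newton iteration for the inverse of `t` modulo `B ^ (2 ^ j)`. -/
def newton (B t : ℕ) : ℕ → ℕ
  | 0 => 1
  | j + 1 => force (newton B t j) fun x ↦
      let M := B ^ (2 ^ (j + 1))
      x * (M + 2 - t * x % M) % M

/-- Computes the reciprocal of the theta series at `B`, modulo `B ^ N`, and checks its digits. -/
def check (B N : ℕ) : Bool :=
  force (B ^ N) fun M ↦
  force (thetaEven B 50) fun a ↦ force (thetaOdd B 50) fun b ↦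
  force (newton B (M + a - b) 14 % M) fun x ↦
  (x * a % M == (x * b + 1) % M) && (windowsCheck B 13 (x / B ^ 50) &&
    windowsCheck B 11 (x / B ^ 7960))

lemma mod_pow_div_pow_mod (x B : ℕ) {k c : ℕ} (h : k < c) :
    x % B ^ c / B ^ k % B = x / B ^ k % B := by
  obtain ⟨e, rfl⟩ := Nat.exists_eq_add_of_lt h
  rw [add_assoc, pow_add, Nat.mod_mul_right_div_self, Nat.mod_mod_of_dvd _ (dvd_pow_self B (by omega))]

lemma digitsCheck_congr {B x y : ℕ} (h : ∀ i < 6, x / B ^ i % B = y / B ^ i % B) :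
    digitsCheck B x = digitsCheck B y := by
  simp only [digitsCheck, h 0 (by norm_num), h 1 (by norm_num), h 2 (by norm_num),
    h 3 (by norm_num), h 4 (by norm_num), h 5 (by norm_num)]

lemma digitsCheck_of_windowsCheck {B d x : ℕ} (h : windowsCheck B d x = true) {i : ℕ}
    (hi : i < 2 ^ d) : digitsCheck B (x / B ^ i) = true := by
  induction d generalizing x i with
  | zero =>
    rw [pow_zero, Nat.lt_one_iff] at hi
    simpa [hi, windowsCheck] using h
  | succ d ih =>
    rw [windowsCheck, force_eq, force_eq, Bool.and_eq_true] at h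
    rcases lt_or_ge i (2 ^ d) with hlt | hge
    · rw [← ih h.1 hlt]
      refine digitsCheck_congr fun j hj ↦ ?_
      rw [Nat.div_div_eq_div_mul, Nat.div_div_eq_div_mul, ← pow_add,
        mod_pow_div_pow_mod _ _ (by omega)]
    · have := ih h.2 (i := i - 2 ^ d) (by rw [pow_succ] at hi; omega)
      rwa [Nat.div_div_eq_div_mul, ← pow_add, Nat.add_sub_of_le hge] at this

lemma thetaEven_sub_thetaOdd (B m : ℕ) : (thetaEven B m - thetaOdd B m : ℤ) =
    ∑ j ∈ range ((2 * m + 1) ^ 2), thetaCoeff j * (B : ℤ) ^ j := by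
  rw [sum_thetaCoeff]
  induction m with
  | zero => simp [thetaEven, thetaOdd]
  | succ m ih =>
    rw [thetaEven, thetaOdd, mul_add_one, sum_range_succ, sum_range_succ, ← add_assoc, ← add_assoc,
      ← ih, (even_two_mul m).add_one.neg_one_pow, (by exact ⟨m + 1, by ring⟩ : Even (2 * m + 1 + 1)).neg_one_pow]
    push_cast
    ring

lemma sum_mul_pow_lt {f : ℕ → ℕ} {B N : ℕ} (h : ∀ n < N, f n < B) :
    ∑ n ∈ range N, f n * B ^ n < B ^ N := by
  induction N with
  | zero => simp
  | succ N ih =>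
    rw [sum_range_succ, pow_succ]
    have h1 := ih fun n hn ↦ h n (by omega)
    have h2 := Nat.mul_le_mul_right (B ^ N) (h N (by omega))
    rw [Nat.succ_mul] at h2
    linarith [mul_comm B (B ^ N)]

lemma sum_mul_pow_div_mod {f : ℕ → ℕ} {B N i : ℕ} (h : ∀ n < N, f n < B) (hi : i < N) :
    (∑ n ∈ range N, f n * B ^ n) / B ^ i % B = f i := by
  have hB : 0 < B := (Nat.zero_le _).trans_lt (h i hi)
  obtain ⟨e, rfl⟩ := Nat.exists_eq_add_of_lt hi
  have e1 : ∑ n ∈ range (i + e + 1), f n * B ^ n = ∑ n ∈ range i, f n * B ^ n +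
      B ^ i * (f i + B * ∑ n ∈ range e, f (i + (n + 1)) * B ^ n) := by
    rw [add_assoc, sum_range_add, sum_range_succ', mul_add, mul_sum, mul_sum, add_zero,
      add_comm (∑ k ∈ range e, _)]
    congr 2
    · ring
    · exact sum_congr rfl fun n _ ↦ by ring
  rw [e1, Nat.add_mul_div_left _ _ (by positivity),
    Nat.div_eq_of_lt (sum_mul_pow_lt fun n hn ↦ h n (by omega)), zero_add, Nat.add_mul_mod_self_left,
    Nat.mod_eq_of_lt (h i hi)]

lemma overpartitionFn_lt {n : ℕ} (hn : n < 10013) : overpartitionFn n < 2 ^ 456 := by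
  have h1 := tsum_overpartitionFn_le (r := 1 / 200) (by norm_num)
  have hs := summable_overpartitionFn_real (Real.exp_pos (-π * (1 / 200))).le
    (Real.exp_lt_one_iff.mpr (by linarith [Real.pi_pos]))
  have h2 := (hs.le_tsum n fun m _ ↦ by positivity).trans h1
  have hsq : √(1 / 200 : ℝ) / 2 ≤ 1 := by
    have : √(1 / 200 : ℝ) ≤ 1 := Real.sqrt_le_one.mpr (by norm_num)
    linarith
  have h3 : (overpartitionFn n : ℝ) ≤ Real.exp (π / (4 * (1 / 200))) * Real.exp (π * n / 200) := by
    rw [← div_le_iff₀ (Real.exp_pos _), div_eq_mul_inv, ← Real.exp_neg,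
      show -(π * n / 200) = n * (-π * (1 / 200)) by ring, Real.exp_nat_mul]
    refine h2.trans ?_
    exact mul_le_of_le_one_left (Real.exp_pos _).le hsq
  have h4 : Real.exp (π / (4 * (1 / 200))) * Real.exp (π * n / 200) < 2 ^ 456 := by
    rw [← Real.exp_add, ← Real.lt_log_iff_exp_lt (by positivity), Real.log_pow]
    have hn' : (n : ℝ) ≤ 10013 := by exact_mod_cast hn.le
    have := Real.log_two_gt_d9
    have := Real.pi_lt_d4
    have := mul_le_mul_of_nonneg_left hn' Real.pi_pos.le
    rw [show π / (4 * (1 / 200)) = 50 * π by ring]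
    push_cast
    linarith
  exact_mod_cast h3.trans_lt h4

lemma laguerre_of_digitsCheck {B N n : ℕ} (hB : ∀ n < N, overpartitionFn n < B) (hn : n + 5 < N)
    (h : digitsCheck B ((∑ n ∈ range N, overpartitionFn n * B ^ n) / B ^ n) = true) :
    3 * (dPbar (n + 2)) ^ 2 - 4 * dPbar (n + 1) * dPbar (n + 3) + dPbar n * dPbar (n + 4) > 0 := by
  have hd (i : ℕ) (hi : i < 6) :
      (∑ n ∈ range N, overpartitionFn n * B ^ n) / B ^ n / B ^ i % B = overpartitionFn (n + i) := by
    rw [Nat.div_div_eq_div_mul, ← pow_add]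
    exact sum_mul_pow_div_mod hB (by omega)
  simp only [digitsCheck, decide_eq_true_eq] at h
  rw [hd 0 (by norm_num), hd 1 (by norm_num), hd 2 (by norm_num), hd 3 (by norm_num),
    hd 4 (by norm_num), hd 5 (by norm_num)] at h
  exact h

lemma laguerre_of_check {B N n : ℕ} (hB : ∀ n < N, overpartitionFn n < B) (hc : check B N = true)
    (hN : N ≤ (2 * 50 + 1) ^ 2) (hn : 50 ≤ n) (hn1 : n < 10000) (hnN : n + 5 < N) :
    3 * (dPbar (n + 2)) ^ 2 - 4 * dPbar (n + 1) * dPbar (n + 3) + dPbar n * dPbar (n + 4) > 0 := by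
  refine laguerre_of_digitsCheck hB hnN ?_
  simp only [check, force_eq, Bool.and_eq_true, beq_iff_eq] at hc
  obtain ⟨h1, h2, h3⟩ := hc
  set S := ∑ n ∈ range N, overpartitionFn n * B ^ n with hS
  set M := B ^ N with hM
  have hMpos : 0 < M := pow_pos ((Nat.zero_le _).trans_lt (hB n (by omega))) N
  have e4 := thetaEven_sub_thetaOdd B 50
  generalize thetaEven B 50 = a at h1 h2 h3 e4
  generalize thetaOdd B 50 = b at h1 h2 h3 e4
  have hxM := Nat.mod_lt (newton B (M + a - b) 14) hMpos
  generalize newton B (M + a - b) 14 % M = x at h1 h2 h3 hxM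
  have hSM : S < M := sum_mul_pow_lt hB
  have hxS : x = S := by
    have e1 := dvd_sum_mul_sum_sub_one (f := fun n ↦ overpartitionFn n) (g := thetaCoeff)
      sum_antidiagonal_thetaCoeff B hN
    rw [← e4] at e1
    have e2 : (M : ℤ) ∣ x * a - (x * b + 1) := by
      exact_mod_cast Nat.modEq_iff_dvd.mp (show (x * b + 1) ≡ x * a [MOD M] from h1.symm)
    have e3 : (M : ℤ) ∣ x - S := by
      rw [hM, hS] at *
      push_cast at *
      convert! dvd_sub (e2.mul_left (∑ n ∈ range N, (overpartitionFn n : ℤ) * (B : ℤ) ^ n))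
        (e1.mul_left x) using 1
      ring
    exact Nat.ModEq.eq_of_lt_of_lt ((Nat.modEq_iff_dvd.mpr e3).symm) hxM hSM
  rw [← hxS]
  rcases lt_or_ge n 8242 with h | h
  · have := digitsCheck_of_windowsCheck h2 (i := n - 50) (by omega)
    rwa [Nat.div_div_eq_div_mul, ← pow_add, Nat.add_sub_of_le hn] at this
  · have := digitsCheck_of_windowsCheck h3 (i := n - 7960) (by omega)
    rwa [Nat.div_div_eq_div_mul, ← pow_add, Nat.add_sub_of_le (by omega)] at this

lemma check_two_pow : check (2 ^ 456) 10013 = true := by decide +kernel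

/-- The Laguerre inequality in the range of the computation. -/
lemma laguerre_of_small {n : ℕ} (hn : 50 ≤ n) (hn1 : n < 10000) :
    3 * (dPbar (n + 2)) ^ 2 - 4 * dPbar (n + 1) * dPbar (n + 3) + dPbar n * dPbar (n + 4) > 0 :=
  laguerre_of_check (fun _ h ↦ overpartitionFn_lt h) check_two_pow (by norm_num) hn hn1 (by omega)

end Overpartition

theorem laguerre2_dPbar (n : ℕ) (hn : 50 ≤ n) :
    3 * (dPbar (n + 2)) ^ 2 - 4 * dPbar (n + 1) * dPbar (n + 3)
      + dPbar n * dPbar (n + 4) > 0 := by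
  rcases lt_or_ge n 10000 with h | h
  · exact Overpartition.laguerre_of_small hn h
  · exact Overpartition.laguerre_of_large h
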